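/- (Białynicki-Birula) Any effective regular action of the (n−1)-dimensional torus T_{n−1} on the affine space A^n over an algebraically closed field K is linearizable: there exists a polynomial automorphism β of A^n such that β⁻¹ ∘ σ(t) ∘ β is a linear map K^n → K^n for every t ∈ T_{n−1}. -/

import Mathlib

/-- Evaluation of a (multivariate) Laurent polynomial `F` at a point `t` of the torus. -/
noncomputable def lEval {K : Type*} [Field K] {r : ℕ}
    (F : (Fin r → ℤ) →₀ K) (t : Fin r → Kˣ) : K :=
  F.sum fun m c => c * ∏ j, ((t j ^ m j : Kˣ) : K)

/-- A map of affine `m`-space is a polynomial map if each component is given by a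
polynomial in the coordinates. -/
def IsPolyMap {K : Type*} [CommSemiring K] {m : ℕ} (f : (Fin m → K) → (Fin m → K)) : Prop :=
  ∃ p : Fin m → MvPolynomial (Fin m) K, ∀ x i, f x i = MvPolynomial.eval x (p i)

/-- A regular torus action on affine space: each component of `σ t x` is a polynomial
in the coordinates `x` whose coefficients are Laurent polynomial functions of `t`. -/
def IsRegularAffineAction {K : Type*} [Field K] {r m : ℕ}
    (σ : (Fin r → Kˣ) → (Fin m → K) → (Fin m → K)) : Prop :=
  ∃ P : Fin m → ((Fin m →₀ ℕ) →₀ ((Fin r → ℤ) →₀ K)),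
    ∀ t x i, σ t x i = (P i).sum fun d F => lEval F t * ∏ j, x j ^ d j


section PartOne
open MvPolynomial

theorem bb_int_jacobson : IsJacobsonRing ℤ := by
  rw [isJacobsonRing_iff_prime_eq]
  intro P hP
  by_cases h : P = ⊥
  · subst h
    rw [eq_bot_iff]
    intro x hx
    rw [Ideal.mem_jacobson_iff] at hx
    by_contra hx0
    have hx0 : x ≠ 0 := hx0
    obtain ⟨p, hp1, hp⟩ := Nat.exists_infinite_primes (x.natAbs + 1)
    have hmem : x ∈ Ideal.jacobson (⊥ : Ideal ℤ) := Ideal.mem_jacobson_iff.2 hx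
    have hpm : (Ideal.span {(p : ℤ)}).IsMaximal :=
      PrincipalIdealRing.isMaximal_of_irreducible (Nat.prime_iff_prime_int.1 hp).irreducible
    have : x ∈ Ideal.span {(p : ℤ)} := by
      rw [Ideal.jacobson, Submodule.mem_sInf] at hmem
      exact hmem _ ⟨bot_le, hpm⟩
    rw [Ideal.mem_span_singleton] at this
    have := Int.natAbs_dvd_natAbs.2 this
    have := Nat.le_of_dvd (Int.natAbs_pos.2 hx0) this
    simp at this
    omega
  · have := Ideal.IsPrime.isMaximal hP h
    exact Ideal.jacobson_eq_self_of_isMaximal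

/-- A field of finite type over `ℤ` is finite. -/
theorem bb_finite_field (R F : Type*) [CommRing R] [Algebra.FiniteType ℤ R] [Field F]
    (f : R →+* F) (hf : Function.Surjective f) : Finite F := by
  have : Algebra.FiniteType ℤ F := Algebra.FiniteType.of_surjective f.toIntAlgHom hf
  have := bb_int_jacobson
  have hfin : Module.Finite ℤ F := finite_of_finite_type_of_isJacobsonRing ℤ F
  obtain ⟨p, hp⟩ := CharP.exists F
  rcases CharP.char_is_prime_or_zero F p with h | h
  · haveI : Fact p.Prime := ⟨h⟩
    letI := ZMod.algebra F p
    haveI : IsScalarTower ℤ (ZMod p) F := IsScalarTower.of_algebraMap_eq (fun x => by simp)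
    haveI : Module.Finite (ZMod p) F := Module.Finite.of_restrictScalars_finite ℤ (ZMod p) F
    exact Module.finite_of_finite (ZMod p)
  · subst h
    haveI : CharZero F := CharP.charP_to_charZero F
    haveI : Algebra.IsIntegral ℤ F := inferInstance
    have : IsField ℤ := isField_of_isIntegral_of_isField (R := ℤ) (S := F)
      (by intro a b hab; simpa using hab) (Field.toIsField F)
    exact absurd this Int.not_isField

theorem bb_residue (R : Type*) [CommRing R] [Nontrivial R] [Algebra.FiniteType ℤ R] :
    ∃ (M : Ideal R), M.IsMaximal ∧ Finite (R ⧸ M) := by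
  obtain ⟨M, hM⟩ := Ideal.exists_maximal R
  refine ⟨M, hM, ?_⟩
  letI : Field (R ⧸ M) := Ideal.Quotient.field M
  exact bb_finite_field R _ (Ideal.Quotient.mk M) Ideal.Quotient.mk_surjective

theorem bb_fixed_point {K : Type*} [Field K] {n : ℕ} (l : ℕ) (hl : l.Prime) (hlK : (l : K) ≠ 0)
    (g : Fin n → MvPolynomial (Fin n) K)
    (hg : ∀ p, (⇑(aeval g : MvPolynomial (Fin n) K →ₐ[K] MvPolynomial (Fin n) K))^[l] p = p) :
    Ideal.span (Set.range fun i => g i - X i) ≠ ⊤ := by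
  classical
  intro htop
  have h1 : (1 : MvPolynomial (Fin n) K) ∈ Ideal.span (Set.range fun i => g i - X i) := by
    rw [htop]; trivial
  rw [Ideal.mem_span_range_iff_exists_fun] at h1
  obtain ⟨a, ha⟩ := h1
  let S : Finset K := (Finset.univ.biUnion fun i => (g i).coeffs) ∪
    (Finset.univ.biUnion fun i => (a i).coeffs) ∪ {(l : K)⁻¹}
  let R : Subalgebra ℤ K := Algebra.adjoin ℤ (S : Set K)
  have hRS : ∀ s ∈ S, s ∈ R := fun s hs => Algebra.subset_adjoin hs
  haveI : Algebra.FiniteType ℤ R := by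
    rw [← Subalgebra.fg_iff_finiteType]
    exact Subalgebra.fg_adjoin_finset S
  let φ : R →+* K := R.val.toRingHom
  have hφ : Function.Injective φ := Subtype.val_injective
  have hmφ : Function.Injective (MvPolynomial.map (σ := Fin n) φ) := MvPolynomial.map_injective φ hφ
  have hg' : ∀ i, ∃ q, MvPolynomial.map φ q = g i := by
    intro i
    have : g i ∈ Set.range (MvPolynomial.map φ) := by
      rw [MvPolynomial.mem_range_map_iff_coeffs_subset]
      intro s hs
      exact ⟨⟨s, hRS s (by simp only [S, Finset.mem_union, Finset.mem_biUnion]; left; left; exact ⟨i, Finset.mem_univ _, hs⟩)⟩, rfl⟩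
    exact this
  have ha' : ∀ i, ∃ q, MvPolynomial.map φ q = a i := by
    intro i
    have : a i ∈ Set.range (MvPolynomial.map φ) := by
      rw [MvPolynomial.mem_range_map_iff_coeffs_subset]
      intro s hs
      exact ⟨⟨s, hRS s (by simp only [S, Finset.mem_union, Finset.mem_biUnion]; left; right; exact ⟨i, Finset.mem_univ _, hs⟩)⟩, rfl⟩
    exact this
  choose g' hg' using hg'
  choose a' ha' using ha'
  have hsum : ∑ i, a' i * (g' i - X i) = 1 := by
    apply hmφ
    simp only [map_sum, map_mul, map_sub, hg', ha', map_X, map_one]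
    exact ha
  let τ : MvPolynomial (Fin n) R →ₐ[R] MvPolynomial (Fin n) R := aeval g'
  have hcomm : ∀ p, MvPolynomial.map φ (τ p) = aeval g (MvPolynomial.map φ p) := by
    intro p
    induction p using MvPolynomial.induction_on with
    | C c => simp [τ, MvPolynomial.algebraMap_eq]
    | add p q hp hq => simp [hp, hq]
    | mul_X p i hp => rw [map_mul, map_mul, hp, map_mul, map_mul]; simp [hg', τ]
  have hcomm' : ∀ k p, MvPolynomial.map φ (τ^[k] p) =
      (⇑(aeval g : MvPolynomial (Fin n) K →ₐ[K] MvPolynomial (Fin n) K))^[k] (MvPolynomial.map φ p) := by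
    intro k
    induction k with
    | zero => simp
    | succ k ih => intro p; rw [Function.iterate_succ_apply, ih, hcomm, Function.iterate_succ_apply]
  have hτ : ∀ p, τ^[l] p = p := fun p => hmφ (by rw [hcomm', hg])
  obtain ⟨M, hM, hMfin⟩ := bb_residue R
  letI : Field (R ⧸ M) := Ideal.Quotient.field M
  haveI : Fintype (R ⧸ M) := Fintype.ofFinite _
  let ψ : R →+* R ⧸ M := Ideal.Quotient.mk M
  let G : Function.End (Fin n → R ⧸ M) := fun x i => eval₂ ψ x (g' i)
  have hG : ∀ x p, eval₂ ψ (G x) p = eval₂ ψ x (τ p) := by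
    intro x p
    induction p using MvPolynomial.induction_on with
    | C c => simp [τ, MvPolynomial.algebraMap_eq]
    | add p q hp hq => simp [hp, hq]
    | mul_X p i hp => rw [map_mul, eval₂_mul, eval₂_mul, hp]; simp [G, τ]
  have hG' : ∀ k x p, eval₂ ψ (G^[k] x) p = eval₂ ψ x (τ^[k] p) := by
    intro k
    induction k with
    | zero => intro x p; rfl
    | succ k ih =>
      intro x p
      rw [Function.iterate_succ_apply, ih, hG, Function.iterate_succ_apply']
  have hGl : G ^ l ^ 1 = 1 := by
    rw [pow_one]
    funext x i
    have := hG' l x (X i)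
    rw [hτ] at this
    simp only [eval₂_X] at this
    have h3 : ∀ k : ℕ, ∀ y, (G ^ k) y = G^[k] y := by
      intro k
      induction k with
      | zero => intro y; rfl
      | succ k ih => intro y; rw [pow_succ, Function.iterate_succ_apply, ← ih]; rfl
    rw [h3]
    exact this
  haveI : Fact l.Prime := ⟨hl⟩
  have hcard := Equiv.Perm.card_fixedPoints_modEq hGl
  have hlF : (l : R ⧸ M) ≠ 0 := by
    have hmem : (l : K)⁻¹ ∈ R := hRS _ (by simp [S])
    have : ((l : R) * ⟨(l : K)⁻¹, hmem⟩ : R) = 1 := by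
      apply hφ
      change (((l : R) : K)) * (l : K)⁻¹ = 1
      simp [hlK]
    intro h0
    have h2 := congrArg ψ this
    rw [map_mul, map_natCast, h0, zero_mul, map_one] at h2
    exact zero_ne_one h2
  have hcop : ¬ l ∣ Fintype.card (Fin n → R ⧸ M) := by
    rw [Fintype.card_fun]
    intro h
    have h2 := hl.dvd_of_dvd_pow h
    apply hlF
    obtain ⟨p, hp⟩ := CharP.exists (R ⧸ M)
    obtain ⟨k, hk, hk2⟩ := FiniteField.card (R ⧸ M) p
    rw [hk2] at h2
    have h3 := (Nat.prime_dvd_prime_iff_eq hl hk).1 (hl.dvd_of_dvd_pow h2)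
    rw [h3]
    exact CharP.cast_eq_zero _ p
  have hne : (Function.fixedPoints G).Nonempty := by
    by_contra hemp
    rw [Set.not_nonempty_iff_eq_empty] at hemp
    apply hcop
    rw [← Nat.modEq_zero_iff_dvd]
    refine hcard.trans ?_
    rw [Fintype.card_eq_zero_iff.2]
    simp [hemp]
  obtain ⟨x, hx⟩ := hne
  have h2 := congrArg (eval₂ ψ x) hsum
  simp only [eval₂_sum, eval₂_mul, eval₂_sub, eval₂_X, eval₂_one] at h2
  apply zero_ne_one (α := R ⧸ M)
  rw [← h2]
  symm
  apply Finset.sum_eq_zero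
  intro i _
  have : eval₂ ψ x (g' i) = x i := congrFun hx i
  rw [this]; simp
end PartOne


section PartTwo
open AddMonoidAlgebra (single)

structure BBGr {K A M : Type*} [Field K] [CommRing A] [Algebra K A] [AddCommGroup M]
    (Φ : A →ₐ[K] AddMonoidAlgebra A M) : Prop where
  sum_eq : ∀ a, (Φ a).coeff.sum (fun _ b => b) = a
  comp_eq : ∀ a w, Φ ((Φ a).coeff w) = single w ((Φ a).coeff w)

def BBHom {K A M : Type*} [Field K] [CommRing A] [Algebra K A] [AddCommGroup M]
    (Φ : A →ₐ[K] AddMonoidAlgebra A M) (w : M) (a : A) : Prop := Φ a = single w a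

variable {K A M : Type*} [Field K] [CommRing A] [Algebra K A] [AddCommGroup M]
    {Φ : A →ₐ[K] AddMonoidAlgebra A M}

theorem BBGr.hom_comp (h : BBGr Φ) (a : A) (w : M) : BBHom Φ w ((Φ a).coeff w) := h.comp_eq a w

theorem BBHom.add {w : M} {a b : A} (ha : BBHom Φ w a) (hb : BBHom Φ w b) : BBHom Φ w (a + b) := by
  unfold BBHom at *; rw [map_add, ha, hb, AddMonoidAlgebra.single_add]

theorem BBHom.smul {w : M} {a : A} (c : K) (ha : BBHom Φ w a) : BBHom Φ w (c • a) := by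
  unfold BBHom at *; rw [map_smul, ha, AddMonoidAlgebra.smul_single]

theorem BBHom.neg {w : M} {a : A} (ha : BBHom Φ w a) : BBHom Φ w (-a) := by
  have := ha.smul (-1); simpa using this

theorem BBHom.sub {w : M} {a b : A} (ha : BBHom Φ w a) (hb : BBHom Φ w b) : BBHom Φ w (a - b) := by
  rw [sub_eq_add_neg]; exact ha.add hb.neg

theorem BBHom.zero (w : M) : BBHom Φ w 0 := by
  unfold BBHom; simp

theorem BBHom.one : BBHom Φ 0 1 := by
  unfold BBHom; rw [map_one, AddMonoidAlgebra.one_def]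

theorem BBHom.algebraMap (c : K) : BBHom Φ 0 (algebraMap K A c) := by
  rw [Algebra.algebraMap_eq_smul_one]; exact BBHom.one.smul c

theorem BBHom.mul {w v : M} {a b : A} (ha : BBHom Φ w a) (hb : BBHom Φ v b) :
    BBHom Φ (w + v) (a * b) := by
  unfold BBHom at *; rw [map_mul, ha, hb, AddMonoidAlgebra.single_mul_single]

theorem BBHom.pow {w : M} {a : A} (ha : BBHom Φ w a) (k : ℕ) : BBHom Φ (k • w) (a ^ k) := by
  induction k with
  | zero => simpa using BBHom.one
  | succ k ih => rw [pow_succ, succ_nsmul]; exact ih.mul ha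

theorem BBHom.prod {ι : Type*} (s : Finset ι) {w : ι → M} {a : ι → A}
    (h : ∀ i ∈ s, BBHom Φ (w i) (a i)) : BBHom Φ (∑ i ∈ s, w i) (∏ i ∈ s, a i) := by
  classical
  induction s using Finset.induction_on with
  | empty => simpa using BBHom.one
  | insert i s hi ih =>
    rw [Finset.sum_insert hi, Finset.prod_insert hi]
    exact (h i (by simp)).mul (ih fun j hj => h j (by simp [hj]))

theorem BBHom.sum {ι : Type*} (s : Finset ι) {w : M} {a : ι → A}
    (h : ∀ i ∈ s, BBHom Φ w (a i)) : BBHom Φ w (∑ i ∈ s, a i) := by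
  classical
  induction s using Finset.induction_on with
  | empty => simpa using BBHom.zero w
  | insert i s hi ih =>
    rw [Finset.sum_insert hi]
    exact (h i (by simp)).add (ih fun j hj => h j (by simp [hj]))

theorem BBHom.unique {w v : M} {a : A} (ha : BBHom Φ w a) (hb : BBHom Φ v a) (h0 : a ≠ 0) :
    w = v := by
  unfold BBHom at *
  exact (AddMonoidAlgebra.single_left_inj h0).1 (ha.symm.trans hb)

theorem BBHom.coeff_self {w : M} {a : A} (ha : BBHom Φ w a) : (Φ a).coeff w = a := by
  unfold BBHom at ha; rw [ha]; simp

theorem BBHom.coeff_ne {w v : M} {a : A} (ha : BBHom Φ w a) (hv : v ≠ w) : (Φ a).coeff v = 0 := by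
  unfold BBHom at ha; rw [ha]; simp [hv.symm]

theorem BBGr.sum_eq' (h : BBGr Φ) (a : A) : ∑ w ∈ (Φ a).coeff.support, (Φ a).coeff w = a :=
  h.sum_eq a

/-- it suffices to check additive statements on homogeneous elements -/
theorem BBGr.induction (h : BBGr Φ) {P : A → Prop} (h0 : P 0) (hadd : ∀ a b, P a → P b → P (a + b))
    (hh : ∀ w a, BBHom Φ w a → P a) (a : A) : P a := by
  rw [← h.sum_eq' a]
  exact Finset.sum_induction _ P hadd h0 (fun w _ => hh w _ (h.hom_comp a w))

theorem BBGr.ne_zero (h : BBGr Φ) {a : A} (ha : a ≠ 0) : Φ a ≠ 0 := by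
  intro h0; apply ha; rw [← h.sum_eq a, h0]; simp

theorem BBGr.factor [IsDomain A] [TwoUniqueSums M] (h : BBGr Φ) {w : M} {a b : A}
    (hab : BBHom Φ w (a * b)) (h0 : a * b ≠ 0) : ∃ u, BBHom Φ u a := by
  classical
  have ha0 : a ≠ 0 := left_ne_zero_of_mul h0
  have hb0 : b ≠ 0 := right_ne_zero_of_mul h0
  have hsa : 0 < (Φ a).coeff.support.card := by
    rw [Finset.card_pos, Finsupp.support_nonempty_iff]
    simpa using h.ne_zero ha0
  have hsb : 0 < (Φ b).coeff.support.card := by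
    rw [Finset.card_pos, Finsupp.support_nonempty_iff]
    simpa using h.ne_zero hb0
  have hcard : (Φ a).coeff.support.card = 1 := by
    by_contra hne
    have h1 : 1 < (Φ a).coeff.support.card * (Φ b).coeff.support.card := by
      have : 2 ≤ (Φ a).coeff.support.card := by omega
      nlinarith
    obtain ⟨p, hp, q, hq, hpq, hup, huq⟩ := TwoUniqueSums.uniqueAdd_of_one_lt_card h1
    have key : ∀ p ∈ (Φ a).coeff.support ×ˢ (Φ b).coeff.support,
        UniqueAdd (Φ a).coeff.support (Φ b).coeff.support p.1 p.2 → p.1 + p.2 = w := by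
      intro p hp hup
      have h2 := AddMonoidAlgebra.coeff_mul_add_of_uniqueAdd hup
      rw [← map_mul] at h2
      by_contra hne
      rw [hab.coeff_ne hne] at h2
      rw [Finset.mem_product, Finsupp.mem_support_iff, Finsupp.mem_support_iff] at hp
      exact mul_ne_zero hp.1 hp.2 h2.symm
    have e1 := key p hp hup
    have e2 := key q hq huq
    rw [Finset.mem_product] at hp hq
    have := hup hq.1 hq.2 (e2.trans e1.symm)
    exact hpq (Prod.ext this.1.symm this.2.symm)
  obtain ⟨u, hu⟩ := Finset.card_eq_one.1 hcard
  refine ⟨u, ?_⟩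
  have h3 := h.sum_eq' a
  rw [hu, Finset.sum_singleton] at h3
  have := h.hom_comp a u
  rwa [h3] at this

theorem BBGr.of_dvd [IsDomain A] [TwoUniqueSums M] (h : BBGr Φ) {w : M} {a b : A}
    (hb : BBHom Φ w b) (h0 : b ≠ 0) (hab : a ∣ b) : ∃ u, BBHom Φ u a := by
  obtain ⟨c, rfl⟩ := hab
  exact h.factor hb h0

theorem BBGr.quot [IsDomain A] [TwoUniqueSums M] (h : BBGr Φ) {u w : M} {a b : A}
    (ha : BBHom Φ u a) (hab : BBHom Φ w (a * b)) (h0 : a * b ≠ 0) : BBHom Φ (w - u) b := by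
  obtain ⟨v, hv⟩ := h.factor (a := b) (b := a) (by rwa [mul_comm]) (by rwa [mul_comm])
  have := (ha.mul hv).unique hab h0
  rw [← this]; simpa using hv

/-- the twist by a character -/
noncomputable def bbTwist (Φ : A →ₐ[K] AddMonoidAlgebra A M) (χ : Multiplicative M →* K) : A →ₐ[K] A :=
  (AddMonoidAlgebra.liftNCAlgHom (AlgHom.id K A)
    (((algebraMap K A : K →+* A) : K →* A).comp χ) (fun _ _ => Commute.all _ _)).comp Φ

theorem BBHom.twist (χ : Multiplicative M →* K) {w : M} {a : A} (ha : BBHom Φ w a) :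
    bbTwist Φ χ a = χ (Multiplicative.ofAdd w) • a := by
  unfold BBHom at ha
  rw [bbTwist, AlgHom.comp_apply, ha]
  simp [AddMonoidAlgebra.liftNCAlgHom, AddMonoidAlgebra.liftNCRingHom, Algebra.smul_def, mul_comm]

theorem BBGr.twist_iterate (h : BBGr Φ) (χ : Multiplicative M →* K) (l : ℕ)
    (hl : ∀ w, χ w ^ l = 1) (a : A) : (bbTwist Φ χ)^[l] a = a := by
  have key : ∀ k w a, BBHom Φ w a → (bbTwist Φ χ)^[k] a = χ (Multiplicative.ofAdd w) ^ k • a := by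
    intro k
    induction k with
    | zero => intro w a _; simp
    | succ k ih =>
      intro w a ha
      rw [Function.iterate_succ_apply, ha.twist χ, ih w _ (ha.smul _), pow_succ, mul_smul]
  refine h.induction (P := fun a => (bbTwist Φ χ)^[l] a = a) ?_ ?_ ?_ a
  · simp
  · intro a b ha hb; rw [iterate_map_add, ha, hb]
  · intro w a ha; rw [key l w a ha, hl, one_smul]

end PartTwo

section PartTwoB
open MvPolynomial

theorem bb_exists_generic {r : ℕ} (S : Finset (Fin r → ℤ)) (hS : ∀ w ∈ S, w ≠ 0) :
    ∃ c : Fin r → ℤ, ∀ w ∈ S, ∑ j, c j * w j ≠ 0 := by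
  classical
  let p : MvPolynomial (Fin r) ℤ := ∏ w ∈ S, ∑ j, C (w j) * X j
  have hp : p ≠ 0 := by
    rw [Finset.prod_ne_zero_iff]
    intro w hw h0
    apply hS w hw
    funext j
    have := congrArg (eval (Pi.single j (1 : ℤ))) h0
    simpa [Pi.single_apply] using this
  have : ∃ c, eval c p ≠ 0 := by
    by_contra hcon
    push Not at hcon
    exact hp (MvPolynomial.funext (fun x => by rw [hcon x, map_zero]))
  obtain ⟨c, hc⟩ := this
  refine ⟨c, fun w hw h0 => hc ?_⟩
  simp only [p, map_prod, map_sum, map_mul, eval_C, eval_X]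
  apply Finset.prod_eq_zero hw
  rw [← h0]
  exact Finset.sum_congr rfl (fun j _ => mul_comm _ _)

theorem bb_exists_fixed {K : Type*} [Field K] [IsAlgClosed K] {n r : ℕ}
    {Φ : MvPolynomial (Fin n) K →ₐ[K] AddMonoidAlgebra (MvPolynomial (Fin n) K) (Fin r → ℤ)}
    (h : BBGr Φ) : ∃ o : Fin n → K, ∀ w a, BBHom Φ w a → w ≠ 0 → eval o a = 0 := by
  classical
  let B : Set (MvPolynomial (Fin n) K) := {a | ∃ w, BBHom Φ w a ∧ w ≠ 0}
  by_cases htop : Ideal.span B = ⊤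
  · exfalso
    have h1 : (1 : MvPolynomial (Fin n) K) ∈ Ideal.span B := by rw [htop]; trivial
    obtain ⟨T, hTB, hT⟩ := Submodule.mem_span_finite_of_mem_span h1
    have hTB' : ∀ a ∈ T, ∃ w, BBHom Φ w a ∧ w ≠ 0 := fun a ha => hTB ha
    choose! wt hwt hwt0 using hTB'
    obtain ⟨c, hc⟩ := bb_exists_generic (T.image wt) (by
      intro w hw
      obtain ⟨a, ha, rfl⟩ := Finset.mem_image.1 hw
      exact hwt0 a ha)
    obtain ⟨l, hlb, hl⟩ := Nat.exists_infinite_primes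
      (T.sup (fun a => (∑ j, c j * wt a j).natAbs) + ringChar K + 1)
    have hlK : (l : K) ≠ 0 := by
      intro h0
      have h2 := ringChar.dvd h0
      rcases (Nat.dvd_prime hl).1 h2 with h3 | h3
      · exact CharP.ringChar_ne_one h3
      · omega
    have : NeZero (l : K) := ⟨hlK⟩
    obtain ⟨ζ, hζ⟩ := HasEnoughRootsOfUnity.exists_primitiveRoot K l
    have hζ0 : ζ ≠ 0 := hζ.ne_zero hl.ne_zero
    let χ : Multiplicative (Fin r → ℤ) →* K :=
      { toFun := fun w => ζ ^ (∑ j, c j * (Multiplicative.toAdd w) j)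
        map_one' := by simp
        map_mul' := by
          intro x y
          rw [← zpow_add₀ hζ0, ← Finset.sum_add_distrib]
          congr 1
          apply Finset.sum_congr rfl
          intro j _
          simp [mul_add] }
    have hχ : ∀ w, χ w ^ l = 1 := by
      intro w
      change (ζ ^ (∑ j, c j * (Multiplicative.toAdd w) j)) ^ l = 1
      rw [← zpow_natCast, zpow_comm, zpow_natCast, hζ.pow_eq_one, one_zpow]
    let g : Fin n → MvPolynomial (Fin n) K := fun i => bbTwist Φ χ (X i)
    have hg : (aeval g : MvPolynomial (Fin n) K →ₐ[K] MvPolynomial (Fin n) K) = bbTwist Φ χ := by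
      apply MvPolynomial.algHom_ext
      intro i
      rw [aeval_X]
    apply bb_fixed_point l hl hlK g
    · intro p
      rw [hg]
      exact h.twist_iterate χ l hχ p
    · have hmem : ∀ a, bbTwist Φ χ a - a ∈ Ideal.span (Set.range fun i => g i - X i) := by
        intro a
        induction a using MvPolynomial.induction_on with
        | C c =>
          have : bbTwist Φ χ (C c) = C c := AlgHom.commutes _ c
          rw [this, sub_self]; exact zero_mem _
        | add p q hp hq =>
          have : bbTwist Φ χ (p + q) - (p + q) = (bbTwist Φ χ p - p) + (bbTwist Φ χ q - q) := by
            rw [map_add]; ring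
          rw [this]; exact add_mem hp hq
        | mul_X p i hp =>
          have : bbTwist Φ χ (p * X i) - (p * X i) =
            bbTwist Φ χ p * (g i - X i) + X i * (bbTwist Φ χ p - p) := by
            rw [map_mul]; ring
          rw [this]
          exact add_mem (Ideal.mul_mem_left _ _ (Ideal.subset_span ⟨i, rfl⟩)) (Ideal.mul_mem_left _ _ hp)
      rw [Ideal.eq_top_iff_one]
      refine (Ideal.span_le.2 ?_) hT
      intro a ha
      have h2 := hmem a
      rw [(hwt a ha).twist χ] at h2
      set m := ∑ j, c j * wt a j with hm
      have hm0 : m ≠ 0 := hc _ (Finset.mem_image_of_mem _ ha)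
      have h3 : χ (Multiplicative.ofAdd (wt a)) = ζ ^ m := rfl
      rw [h3] at h2
      have h4 : ζ ^ m ≠ 1 := by
        intro h5
        rw [hζ.zpow_eq_one_iff_dvd] at h5
        have h6 := Int.le_of_dvd (by positivity) ((dvd_abs _ _).2 h5)
        rw [Int.abs_eq_natAbs] at h6
        have h7 : m.natAbs ≤ T.sup (fun a => (∑ j, c j * wt a j).natAbs) :=
          Finset.le_sup (f := fun a => (∑ j, c j * wt a j).natAbs) ha
        omega
      have h5 : a = C ((ζ ^ m - 1)⁻¹) * (ζ ^ m • a - a) := by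
        have h6 : ζ ^ m - 1 ≠ 0 := sub_ne_zero.2 h4
        have : ζ ^ m • a - a = C (ζ ^ m - 1) * a := by
          rw [MvPolynomial.smul_eq_C_mul, C_sub, C_1]; ring
        rw [this, ← mul_assoc, ← C_mul, inv_mul_cancel₀ h6, C_1, one_mul]
      rw [h5]
      exact Ideal.mul_mem_left _ _ h2
  · obtain ⟨J, hJ, hBJ⟩ := Ideal.exists_le_maximal _ htop
    obtain ⟨o, ho⟩ := MvPolynomial.isMaximal_iff_eq_vanishingIdeal_singleton.1 hJ
    refine ⟨o, fun w a ha hw => ?_⟩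
    have : a ∈ J := hBJ (Ideal.subset_span ⟨w, ha, hw⟩)
    rw [ho, mem_vanishingIdeal_singleton_iff] at this
    simpa using this
end PartTwoB


section PartThree
open MvPolynomial

/-- differential at the point `o` -/
noncomputable def bbD {K : Type*} [Field K] {n : ℕ} (o : Fin n → K) :
    MvPolynomial (Fin n) K →ₗ[K] (Fin n → K) :=
  LinearMap.pi fun i => (aeval o : MvPolynomial (Fin n) K →ₐ[K] K).toLinearMap ∘ₗ (pderiv i).toLinearMap

/-- the maximal ideal of the point `o` -/
noncomputable def bbM {K : Type*} [Field K] {n : ℕ} (o : Fin n → K) : Ideal (MvPolynomial (Fin n) K) :=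
  RingHom.ker (eval o)

variable {K : Type*} [Field K] {n : ℕ} {o : Fin n → K}

theorem bbM_mem {a : MvPolynomial (Fin n) K} : a ∈ bbM o ↔ eval o a = 0 := RingHom.mem_ker

theorem bbD_mul (a b : MvPolynomial (Fin n) K) :
    bbD o (a * b) = eval o a • bbD o b + eval o b • bbD o a := by
  funext i
  simp [bbD, Derivation.leibniz, aeval_eq_eval]

theorem bbD_C (c : K) : bbD o (C c) = 0 := by
  funext i
  simp [bbD]

theorem bbD_X (i : Fin n) : bbD o (X i) = Pi.single i 1 := by
  classical
  funext j
  simp only [bbD, LinearMap.pi_apply, LinearMap.comp_apply, Pi.single_apply]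
  by_cases h : j = i
  · subst h; simp
  · simp [pderiv_X, Pi.single_apply, h, Ne.symm h]

theorem bbM_exists {a : MvPolynomial (Fin n) K} (ha : a ∈ bbM o) :
    ∃ g : Fin n → MvPolynomial (Fin n) K, ∑ i, g i * (X i - C (o i)) = a := by
  rw [← Ideal.mem_span_range_iff_exists_fun]
  have key : ∀ a : MvPolynomial (Fin n) K,
      a - C (eval o a) ∈ Ideal.span (Set.range fun i => (X i - C (o i) : MvPolynomial (Fin n) K)) := by
    intro a
    induction a using MvPolynomial.induction_on with
    | C c => simp
    | add p q hp hq =>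
      have : p + q - C (eval o (p + q)) = (p - C (eval o p)) + (q - C (eval o q)) := by
        rw [map_add, C_add]; ring
      rw [this]; exact add_mem hp hq
    | mul_X p i hp =>
      have : p * X i - C (eval o (p * X i)) = p * (X i - C (o i)) + C (o i) * (p - C (eval o p)) := by
        rw [map_mul, eval_X, C_mul]; ring
      rw [this]
      exact add_mem (Ideal.mul_mem_left _ _ (Ideal.subset_span ⟨i, rfl⟩)) (Ideal.mul_mem_left _ _ hp)
  have := key a
  rwa [bbM_mem.1 ha, C_0, sub_zero] at this

theorem bbM_sq {a : MvPolynomial (Fin n) K} (ha : a ∈ bbM o) (hd : bbD o a = 0) : a ∈ bbM o ^ 2 := by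
  classical
  obtain ⟨g, hg⟩ := bbM_exists ha
  have hX : ∀ i, (X i - C (o i) : MvPolynomial (Fin n) K) ∈ bbM o := fun i => by simp [bbM_mem]
  have h0 : ∀ i, eval o (g i) = 0 := by
    intro i
    have := congrFun hd i
    rw [← hg, map_sum] at this
    simp only [bbD_mul, map_sub, bbD_X, bbD_C, eval_X, eval_C, sub_self, zero_smul, add_zero, sub_zero,
      Finset.sum_apply, Pi.smul_apply, Pi.single_apply, smul_eq_mul, Pi.zero_apply] at this
    simpa using this
  rw [← hg, pow_two]
  exact sum_mem fun i _ => Ideal.mul_mem_mul (bbM_mem.2 (h0 i)) (hX i)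

variable {r : ℕ}
    {Φ : MvPolynomial (Fin n) K →ₐ[K] AddMonoidAlgebra (MvPolynomial (Fin n) K) (Fin r → ℤ)}

theorem bbHom_C (c : K) : BBHom Φ 0 (C c) := BBHom.algebraMap c

theorem BBGr.exists_basis (h : BBGr Φ) (ho : ∀ w a, BBHom Φ w a → w ≠ 0 → eval o a = 0) :
    ∃ (f : Fin n → MvPolynomial (Fin n) K) (w : Fin n → (Fin r → ℤ)),
      (∀ i, BBHom Φ (w i) (f i)) ∧ (∀ i, eval o (f i) = 0) ∧ LinearIndependent K (fun i => bbD o (f i)) ∧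
      ∀ i, Irreducible (f i) := by
  classical
  let H : Set (MvPolynomial (Fin n) K) := {a | ∃ w, BBHom Φ w a ∧ eval o a = 0}
  have hspan : Submodule.span K (bbD o '' H) = ⊤ := by
    have hall : ∀ a, bbD o a ∈ Submodule.span K (bbD o '' H) := by
      refine h.induction ?_ ?_ ?_
      · simp
      · intro a b ha hb; rw [map_add]; exact add_mem ha hb
      · intro w a ha
        have h1 : bbD o a = bbD o (a - C (eval o a)) := by rw [map_sub, bbD_C, sub_zero]
        rw [h1]
        apply Submodule.subset_span
        refine ⟨_, ?_, rfl⟩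
        by_cases hw : w = 0
        · subst hw
          exact ⟨0, ha.sub (bbHom_C _), by simp⟩
        · have h2 := ho w a ha hw
          rw [h2, C_0, sub_zero]
          exact ⟨w, ha, h2⟩
    rw [eq_top_iff]
    intro v _
    have h2 : v = bbD o (∑ i, C (v i) * X i) := by
      rw [map_sum]
      simp only [bbD_mul, bbD_X, bbD_C, smul_zero, add_zero, eval_C]
      funext j
      simp [Finset.sum_apply, Pi.single_apply]
    rw [h2]
    exact hall _
  obtain ⟨b, hbs, hbspan, hbl⟩ := exists_linearIndependent K (bbD o '' H)
  rw [hspan] at hbspan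
  let B : Module.Basis b K (Fin n → K) := Module.Basis.mk hbl (by rw [Subtype.range_coe, hbspan])
  let e : Fin n ≃ b := (Pi.basisFun K (Fin n)).indexEquiv B
  have hex : ∀ i : Fin n, ∃ (p : MvPolynomial (Fin n) K) (w : Fin r → ℤ) (c : Kˣ), BBHom Φ w p ∧
      eval o p = 0 ∧ Irreducible p ∧ bbD o p = c • (e i : Fin n → K) := by
    intro i
    obtain ⟨a, ⟨w, haw, hao⟩, hda⟩ := hbs (e i).2
    have hne : bbD o a ≠ 0 := by rw [hda]; exact hbl.ne_zero (e i)
    have ha0 : a ≠ 0 := by rintro rfl; simp at hne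
    -- an irreducible factor vanishing at `o`
    have hfac : ∃ p q, a = p * q ∧ Irreducible p ∧ eval o p = 0 := by
      clear hda hne haw
      induction a using WfDvdMonoid.induction_on_irreducible with
      | zero => exact absurd rfl ha0
      | unit u hu =>
        exact absurd hao ((hu.map (eval o)).ne_zero)
      | mul a p ha hp ih =>
        rw [map_mul] at hao
        rcases mul_eq_zero.1 hao with h1 | h1
        · exact ⟨p, a, rfl, hp, h1⟩
        · obtain ⟨p', q', rfl, hp', hpo⟩ := ih h1 ha
          exact ⟨p', p * q', by ring, hp', hpo⟩
    obtain ⟨p, q, rfl, hp, hpo⟩ := hfac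
    obtain ⟨u, hu⟩ := h.factor haw ha0
    have hd : bbD o (p * q) = eval o q • bbD o p := by rw [bbD_mul, hpo, zero_smul, zero_add]
    have hq0 : eval o q ≠ 0 := by
      intro h0; rw [hd, h0, zero_smul] at hne; exact hne rfl
    refine ⟨p, u, (Units.mk0 _ hq0)⁻¹, hu, hpo, hp, ?_⟩
    rw [← hda, hd, ← Units.smul_mk0 hq0, inv_smul_smul]
  choose p w c h1 h2 h3 h4 using hex
  refine ⟨p, w, h1, h2, ?_, h3⟩
  have : (fun i => bbD o (p i)) = c • (fun i => (e i : Fin n → K)) := by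
    funext i; rw [h4]; rfl
  rw [this]
  apply LinearIndependent.units_smul
  exact hbl.comp e e.injective

end PartThree

section PartThreeB
open MvPolynomial

/-- The data of a good system of homogeneous local parameters. -/
structure BBSys {K : Type*} [Field K] {n r : ℕ}
    (Φ : MvPolynomial (Fin n) K →ₐ[K] AddMonoidAlgebra (MvPolynomial (Fin n) K) (Fin r → ℤ))
    (o : Fin n → K) (f : Fin n → MvPolynomial (Fin n) K) (w : Fin n → (Fin r → ℤ)) : Prop where
  gr : BBGr Φ
  fix : ∀ w a, BBHom Φ w a → w ≠ 0 → eval o a = 0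
  hom : ∀ i, BBHom Φ (w i) (f i)
  ev : ∀ i, eval o (f i) = 0
  li : LinearIndependent K (fun i => bbD o (f i))
  irr : ∀ i, Irreducible (f i)

/-- monomials in `f` -/
noncomputable def bbMon {A : Type*} [CommRing A] {n : ℕ} (f : Fin n → A) (c : Fin n → ℕ) : A :=
  ∏ i, f i ^ c i

/-- weight of a monomial -/
def bbWt {n r : ℕ} (w : Fin n → (Fin r → ℤ)) (c : Fin n → ℕ) : Fin r → ℤ := ∑ i, c i • w i

theorem bbMon_add {A : Type*} [CommRing A] {n : ℕ} (f : Fin n → A) (c d : Fin n → ℕ) :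
    bbMon f (c + d) = bbMon f c * bbMon f d := by
  simp [bbMon, pow_add, Finset.prod_mul_distrib]

theorem bbWt_add {n r : ℕ} (w : Fin n → (Fin r → ℤ)) (c d : Fin n → ℕ) :
    bbWt w (c + d) = bbWt w c + bbWt w d := by
  simp [bbWt, add_smul, Finset.sum_add_distrib]

variable {K : Type*} [Field K] {n r : ℕ}
    {Φ : MvPolynomial (Fin n) K →ₐ[K] AddMonoidAlgebra (MvPolynomial (Fin n) K) (Fin r → ℤ)}
    {o : Fin n → K} {f : Fin n → MvPolynomial (Fin n) K} {w : Fin n → (Fin r → ℤ)}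

theorem BBSys.hom_mon (h : BBSys Φ o f w) (c : Fin n → ℕ) : BBHom Φ (bbWt w c) (bbMon f c) :=
  BBHom.prod _ fun i _ => (h.hom i).pow (c i)

theorem BBSys.mon_mem (h : BBSys Φ o f w) (c : Fin n → ℕ) : bbMon f c ∈ bbM o ^ (∑ i, c i) := by
  unfold bbMon
  rw [← Finset.prod_pow_eq_pow_sum]
  exact Ideal.prod_mem_prod fun i _ => Ideal.pow_mem_pow (bbM_mem.2 (h.ev i)) _

/-- span of monomials of degree `k` -/
noncomputable def bbV (f : Fin n → MvPolynomial (Fin n) K) (k : ℕ) :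
    Submodule K (MvPolynomial (Fin n) K) :=
  Submodule.span K {b | ∃ c : Fin n → ℕ, ∑ i, c i = k ∧ b = bbMon f c}

theorem bbV_mul {k l : ℕ} {a b : MvPolynomial (Fin n) K} (ha : a ∈ bbV f k) (hb : b ∈ bbV f l) :
    a * b ∈ bbV f (k + l) := by
  have h1 := Submodule.mul_mem_mul ha hb
  unfold bbV at h1
  rw [Submodule.span_mul_span] at h1
  refine Submodule.span_mono ?_ h1
  rintro _ ⟨_, ⟨c, hc, rfl⟩, _, ⟨d, hd, rfl⟩, rfl⟩
  exact ⟨c + d, by simp [Finset.sum_add_distrib, hc, hd], (bbMon_add f c d).symm⟩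

theorem BBSys.V_le (h : BBSys Φ o f w) {k : ℕ} {a : MvPolynomial (Fin n) K} (ha : a ∈ bbV f k) :
    a ∈ bbM o ^ k := by
  have : bbV f k ≤ (bbM o ^ k).restrictScalars K := by
    unfold bbV
    rw [Submodule.span_le]
    rintro _ ⟨c, rfl, rfl⟩
    exact h.mon_mem c
  exact this ha

theorem BBSys.approx_one (h : BBSys Φ o f w) {a : MvPolynomial (Fin n) K} (ha : a ∈ bbM o) :
    ∃ b ∈ bbV f 1, a - b ∈ bbM o ^ 2 := by
  classical
  let B := basisOfLinearIndependentOfCardEqFinrank' _ h.li (by simp)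
  let c := B.repr (bbD o a)
  refine ⟨∑ i, c i • f i, ?_, ?_⟩
  · refine sum_mem fun i _ => Submodule.smul_mem _ _ (Submodule.subset_span ⟨Pi.single i 1, by simp, ?_⟩)
    unfold bbMon
    rw [Finset.prod_eq_single i]
    · simp
    · intro j _ hj; simp [hj]
    · simp
  · apply bbM_sq
    · refine sub_mem ha (sum_mem fun i _ => ?_)
      rw [bbM_mem, smul_eval, h.ev i, mul_zero]
    · rw [map_sub, map_sum, sub_eq_zero]
      have := B.sum_repr (bbD o a)
      rw [← this]
      apply Finset.sum_congr rfl
      intro i _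
      rw [map_smul]
      congr 1
      simp [B]

theorem BBSys.approx (h : BBSys Φ o f w) (k : ℕ) {a : MvPolynomial (Fin n) K} (ha : a ∈ bbM o ^ k) :
    ∃ b ∈ bbV f k, a - b ∈ bbM o ^ (k + 1) := by
  induction k generalizing a with
  | zero =>
    refine ⟨C (eval o a), ?_, ?_⟩
    · have : (C (eval o a) : MvPolynomial (Fin n) K) = eval o a • 1 := by
        rw [smul_eq_C_mul, mul_one]
      rw [this]
      exact Submodule.smul_mem _ _ (Submodule.subset_span ⟨0, by simp, by simp [bbMon]⟩)
    · simp [bbM_mem]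
  | succ k ih =>
    rw [pow_succ] at ha
    refine Submodule.mul_induction_on ha ?_ ?_
    · intro x hx y hy
      obtain ⟨b, hb, hxb⟩ := ih hx
      obtain ⟨b', hb', hyb⟩ := h.approx_one hy
      refine ⟨b * b', bbV_mul hb hb', ?_⟩
      have e : x * y - b * b' = b * (y - b') + (x - b) * y := by ring
      rw [e]
      refine add_mem ?_ ?_
      · have := Ideal.mul_mem_mul (h.V_le hb) hyb
        rwa [← pow_add] at this
      · have := Ideal.mul_mem_mul hxb hy
        rwa [← pow_succ] at this
    · rintro x y ⟨b, hb, hxb⟩ ⟨b', hb', hyb⟩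
      refine ⟨b + b', add_mem hb hb', ?_⟩
      have e : x + y - (b + b') = (x - b) + (y - b') := by ring
      rw [e]
      exact add_mem hxb hyb

theorem BBSys.coeff_mem_one (h : BBSys Φ o f w) {a : MvPolynomial (Fin n) K} (ha : a ∈ bbM o)
    (u : Fin r → ℤ) : (Φ a).coeff u ∈ bbM o := by
  by_cases hu : u = 0
  · subst hu
    have h1 := congrArg (eval o) (h.gr.sum_eq' a)
    rw [map_sum, bbM_mem.1 ha] at h1
    rw [bbM_mem, ← h1]
    symm
    apply Finset.sum_eq_single
    · intro v _ hv; exact h.fix v _ (h.gr.hom_comp a v) hv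
    · intro hv; rw [Finsupp.notMem_support_iff.1 hv, map_zero]
  · exact bbM_mem.2 (h.fix u _ (h.gr.hom_comp a u) hu)

theorem BBSys.coeff_mem (h : BBSys Φ o f w) (k : ℕ) {a : MvPolynomial (Fin n) K} (ha : a ∈ bbM o ^ k)
    (u : Fin r → ℤ) : (Φ a).coeff u ∈ bbM o ^ k := by
  classical
  induction k generalizing a u with
  | zero => simp
  | succ k ih =>
    rw [pow_succ] at ha
    refine Submodule.mul_induction_on ha ?_ ?_
    · intro x hx y hy
      rw [← h.gr.sum_eq' x, ← h.gr.sum_eq' y, Finset.sum_mul_sum, map_sum, AddMonoidAlgebra.coeff_sum,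
        Finsupp.finset_sum_apply]
      refine sum_mem fun s _ => ?_
      rw [map_sum, AddMonoidAlgebra.coeff_sum, Finsupp.finset_sum_apply]
      refine sum_mem fun t _ => ?_
      have hst := (h.gr.hom_comp x s).mul (h.gr.hom_comp y t)
      by_cases hu : u = s + t
      · subst hu
        rw [hst.coeff_self, pow_succ]
        exact Ideal.mul_mem_mul (ih hx s) (h.coeff_mem_one hy t)
      · rw [hst.coeff_ne hu]; exact zero_mem _
    · intro x y hx hy
      rw [map_add, AddMonoidAlgebra.coeff_add, Finsupp.add_apply]
      exact add_mem hx hy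

theorem BBSys.approx_hom (h : BBSys Φ o f w) (k : ℕ) {u : Fin r → ℤ} {a : MvPolynomial (Fin n) K}
    (hu : BBHom Φ u a) (ha : a ∈ bbM o ^ k) :
    ∃ b ∈ Submodule.span K {b | ∃ c : Fin n → ℕ, ∑ i, c i = k ∧ bbWt w c = u ∧ b = bbMon f c},
      a - b ∈ bbM o ^ (k + 1) ∧ BBHom Φ u b := by
  obtain ⟨b, hb, hab⟩ := h.approx k ha
  refine ⟨(Φ b).coeff u, ?_, ?_, h.gr.hom_comp b u⟩
  · unfold bbV at hb
    clear hab
    induction hb using Submodule.span_induction with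
    | mem x hx =>
      obtain ⟨c, hc, rfl⟩ := hx
      by_cases hw : u = bbWt w c
      · rw [hw, (h.hom_mon c).coeff_self]
        exact Submodule.subset_span ⟨c, hc, rfl, rfl⟩
      · rw [(h.hom_mon c).coeff_ne hw]; exact zero_mem _
    | zero => simp
    | add x y _ _ hx hy =>
      rw [map_add, AddMonoidAlgebra.coeff_add, Finsupp.add_apply]
      exact add_mem hx hy
    | smul t x _ hx =>
      rw [map_smul, AddMonoidAlgebra.coeff_smul, Finsupp.smul_apply]
      exact Submodule.smul_mem _ _ hx
  · have := h.coeff_mem _ hab u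
    rwa [map_sub, AddMonoidAlgebra.coeff_sub, Finsupp.sub_apply, hu.coeff_self] at this

theorem BBSys.exists_mon (h : BBSys Φ o f w) (k : ℕ) {u : Fin r → ℤ} {a : MvPolynomial (Fin n) K}
    (hu : BBHom Φ u a) (ha : a ∈ bbM o ^ k) (h0 : a ≠ 0) :
    ∃ c : Fin n → ℕ, k ≤ ∑ i, c i ∧ bbWt w c = u := by
  classical
  have hne : bbM o ≠ ⊤ := by
    rw [Ideal.ne_top_iff_one, bbM_mem]; simp
  have hkr := Ideal.iInf_pow_eq_bot_of_isDomain (bbM o) hne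
  have hex : ∃ j, a ∉ bbM o ^ j := by
    by_contra hcon
    push Not at hcon
    have : a ∈ ⨅ i, bbM o ^ i := by rw [Submodule.mem_iInf]; exact hcon
    rw [hkr] at this
    exact h0 this
  have hj := Nat.find_spec hex
  set j := Nat.find hex with hjdef
  have hkj : k < j := by
    by_contra hcon
    push Not at hcon
    exact hj (Ideal.pow_le_pow_right hcon ha)
  obtain ⟨i, hi⟩ : ∃ i, j = i + 1 := ⟨j - 1, by omega⟩
  have hai : a ∈ bbM o ^ i := by
    by_contra hcon
    have := Nat.find_min' hex hcon
    omega
  obtain ⟨b, hb, hab, _⟩ := h.approx_hom i hu hai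
  by_contra hcon
  push Not at hcon
  have hemp : {b | ∃ c : Fin n → ℕ, ∑ i, c i = i ∧ bbWt w c = u ∧ b = bbMon f c} = ∅ := by
    rw [Set.eq_empty_iff_forall_notMem]
    rintro _ ⟨c, hc, hcu, _⟩
    exact hcon c (by omega) hcu
  rw [hemp, Submodule.span_empty, Submodule.mem_bot] at hb
  rw [hb, sub_zero, ← hi] at hab
  exact hj hab

/-- The case without nontrivial invariant monomials. -/
theorem BBSys.caseA (h : BBSys Φ o f w) (hA : ∀ c, bbWt w c = 0 → c = 0)
    {u : Fin r → ℤ} {a : MvPolynomial (Fin n) K} (hu : BBHom Φ u a) :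
    a ∈ Algebra.adjoin K (Set.range f) := by
  classical
  have hmon : ∀ c, bbMon f c ∈ Algebra.adjoin K (Set.range f) := by
    intro c
    unfold bbMon
    exact prod_mem fun i _ => pow_mem (Algebra.subset_adjoin (Set.mem_range_self i)) _
  have hfin : {c : Fin n → ℕ | bbWt w c = u}.Finite := by
    have hpwo : {c : Fin n → ℕ | bbWt w c = u}.IsPWO := by
      refine Set.IsPWO.mono (Set.IsPWO.pi (s := fun _ : Fin n => (Set.univ : Set ℕ)) fun i => ?_) (by simp)
      exact Set.isPWO_of_wellQuasiOrderedLE _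
    have hanti : IsAntichain (· ≤ ·) {c : Fin n → ℕ | bbWt w c = u} := by
      intro c hc d hd hne hle
      obtain ⟨e, rfl⟩ := exists_add_of_le hle
      have h1 : bbWt w (c + e) = u := hd
      rw [bbWt_add, show bbWt w c = u from hc] at h1
      have := hA e (by simpa using h1)
      apply hne; rw [this, add_zero]
    exact hanti.finite_of_partiallyWellOrderedOn hpwo
  have hex : ∀ k, ∃ b ∈ Algebra.adjoin K (Set.range f), a - b ∈ bbM o ^ k ∧ BBHom Φ u (a - b) := by
    intro k
    induction k with
    | zero => exact ⟨0, zero_mem _, by simp, by simpa using hu⟩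
    | succ k ih =>
      obtain ⟨b, hb, hab, hh⟩ := ih
      obtain ⟨b', hb', hab', hh'⟩ := h.approx_hom k hh hab
      refine ⟨b + b', add_mem hb ?_, ?_, ?_⟩
      · have : Submodule.span K {b | ∃ c : Fin n → ℕ, ∑ i, c i = k ∧ bbWt w c = u ∧ b = bbMon f c} ≤
            Subalgebra.toSubmodule (Algebra.adjoin K (Set.range f)) := by
          rw [Submodule.span_le]
          rintro _ ⟨c, _, _, rfl⟩
          exact hmon c
        exact this hb'
      · rw [← sub_sub]; exact hab'
      · rw [← sub_sub]; exact hh.sub hh'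
  obtain ⟨N, hN⟩ : ∃ N, ∀ c ∈ {c : Fin n → ℕ | bbWt w c = u}, ∑ i, c i < N :=
    ⟨hfin.toFinset.sup (fun c => ∑ i, c i) + 1, fun c hc =>
      Nat.lt_succ_of_le (Finset.le_sup (f := fun c : Fin n → ℕ => ∑ i, c i) (hfin.mem_toFinset.2 hc))⟩
  obtain ⟨b, hb, hab, hh⟩ := hex N
  by_cases h0 : a - b = 0
  · rw [sub_eq_zero.1 h0]; exact hb
  · obtain ⟨c, hc, hcu⟩ := h.exists_mon N hh hab h0
    have := hN c hcu
    omega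

end PartThreeB


section PartFour

theorem bb_kernel {n r : ℕ} (hr : r = n - 1) (w : Fin n → (Fin r → ℤ))
    (hw : ∀ l : Fin r → ℤ, l ≠ 0 → ∃ i, ∑ j, l j * w i j ≠ 0)
    (v0 : Fin n → ℕ) (hv0 : v0 ≠ 0) (hwv : bbWt w v0 = 0) :
    ∃ v : Fin n → ℕ, v ≠ 0 ∧ bbWt w v = 0 ∧ (∀ m : ℕ, (∀ i, m ∣ v i) → m = 1) ∧
      ∀ z : Fin n → ℤ, ∑ i, z i • w i = 0 → ∃ k : ℤ, ∀ i, z i = k * v i := by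
  classical
  have hn : 0 < n := by
    rcases Nat.eq_zero_or_pos n with h | h
    · subst h; exact absurd (Subsingleton.elim _ _) hv0
    · exact h
  let W : Matrix (Fin r) (Fin n) ℚ := fun j i => (w i j : ℚ)
  have hrow : LinearIndependent ℚ W.row := by
    rw [Fintype.linearIndependent_iff]
    intro g hg
    obtain ⟨b, hb⟩ := IsLocalization.exist_integer_multiples_of_finite (nonZeroDivisors ℤ) g
    choose l hl using hb
    have hl' : ∀ j, (l j : ℚ) = (b : ℤ) * g j := fun j => by
      have := hl j
      simpa [Submonoid.smul_def] using this
    have hb0 : ((b : ℤ) : ℚ) ≠ 0 := by exact_mod_cast nonZeroDivisors.coe_ne_zero b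
    have hl0 : l = 0 := by
      by_contra hne
      obtain ⟨i, hi⟩ := hw l hne
      apply hi
      have h1 := congrFun hg i
      simp only [Finset.sum_apply, Pi.smul_apply, smul_eq_mul, Pi.zero_apply] at h1
      have h2 : ((∑ j, l j * w i j : ℤ) : ℚ) = (b : ℤ) * ∑ j, g j * W.row j i := by
        push_cast
        rw [Finset.mul_sum]
        apply Finset.sum_congr rfl
        intro j _
        rw [hl' j]
        simp only [Matrix.row, W]
        ring
      rw [h1, mul_zero] at h2
      exact_mod_cast h2
    intro j
    have := hl' j
    rw [hl0] at this
    simp only [Pi.zero_apply, Int.cast_zero] at this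
    exact (mul_eq_zero.1 this.symm).resolve_left hb0
  have hrank := hrow.rank_matrix
  have hker : Module.finrank ℚ (LinearMap.ker W.mulVecLin) = 1 := by
    have := LinearMap.finrank_range_add_finrank_ker W.mulVecLin
    change W.rank + _ = _ at this
    rw [hrank] at this
    simp at this
    omega
  have hmem : ∀ z : Fin n → ℤ, ∑ i, z i • w i = 0 → (fun i => (z i : ℚ)) ∈ LinearMap.ker W.mulVecLin := by
    intro z hz
    rw [LinearMap.mem_ker, Matrix.mulVecLin_apply]
    funext j
    have := congrFun hz j
    simp only [Finset.sum_apply, Pi.smul_apply, smul_eq_mul, Pi.zero_apply] at this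
    simp only [Matrix.mulVec, dotProduct, W, Pi.zero_apply]
    have h2 : ((∑ i, z i * w i j : ℤ) : ℚ) = 0 := by rw [this]; simp
    push_cast at h2
    rw [← h2]
    exact Finset.sum_congr rfl fun i _ => mul_comm _ _
  -- primitive vector
  let g := Finset.univ.gcd v0
  obtain ⟨i0, hi0⟩ : ∃ i, v0 i ≠ 0 := by
    by_contra hcon
    push Not at hcon
    exact hv0 (funext hcon)
  have hg0 : g ≠ 0 := fun h => hi0 (Finset.gcd_eq_zero_iff.1 h i0 (Finset.mem_univ _))
  obtain ⟨v, hv, hv1⟩ := Finset.extract_gcd v0 (s := Finset.univ) ⟨i0, Finset.mem_univ _⟩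
  have hv' : ∀ i, v0 i = g * v i := fun i => hv i (Finset.mem_univ _)
  have hvi0 : v i0 ≠ 0 := by
    intro h; apply hi0; rw [hv', h, mul_zero]
  have hprim : ∀ m : ℕ, (∀ i, m ∣ v i) → m = 1 := by
    intro m hm
    have := Finset.dvd_gcd (s := Finset.univ) (f := v) fun i _ => hm i
    rw [hv1] at this
    exact Nat.dvd_one.1 this
  have hwv' : bbWt w v = 0 := by
    have h1 : bbWt w v0 = g • bbWt w v := by
      unfold bbWt
      rw [Finset.smul_sum]
      apply Finset.sum_congr rfl
      intro i _
      rw [hv', mul_smul]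
    rw [hwv] at h1
    funext j
    have := congrFun h1 j
    simp only [Pi.zero_apply, Pi.smul_apply, nsmul_eq_mul] at this
    have h2 : (g : ℤ) ≠ 0 := by exact_mod_cast hg0
    exact (mul_eq_zero.1 this.symm).resolve_left h2
  refine ⟨v, fun h => hvi0 (congrFun h i0), hwv', hprim, ?_⟩
  intro z hz
  have hvk := hmem (fun i => (v i : ℤ)) (by
    have := hwv'
    unfold bbWt at this
    simpa using this)
  have hzk := hmem z hz
  obtain ⟨q, hq⟩ := (finrank_eq_one_iff_of_nonzero' (⟨_, hvk⟩ : LinearMap.ker W.mulVecLin) (by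
    intro h
    have := congrFun (congrArg Subtype.val h) i0
    simp at this
    exact hvi0 this)).1 hker ⟨_, hzk⟩
  have hq' : ∀ i, q * (v i : ℚ) = z i := fun i => by
    have := congrFun (congrArg Subtype.val hq) i
    simpa using this
  have hden : ∀ i, (q.den : ℤ) * z i = q.num * v i := by
    intro i
    have h1 := hq' i
    have h2 : (q.den : ℚ) ≠ 0 := by exact_mod_cast q.den_nz
    have h3 : q = q.num / q.den := (Rat.num_div_den q).symm
    have h4 : (q.den : ℚ) * z i = q.num * v i := by
      rw [← h1]
      have : (q.den : ℚ) * q = q.num := Rat.den_mul_eq_num q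
      rw [← mul_assoc, this]
    exact_mod_cast h4
  have hd1 : q.den = 1 := by
    apply hprim
    intro i
    have h1 : (q.den : ℤ) ∣ q.num * v i := ⟨_, (hden i).symm⟩
    have h2 : (q.den) ∣ q.num.natAbs * v i := by
      have := Int.natAbs_dvd_natAbs.2 h1
      simpa [Int.natAbs_mul] using this
    exact (q.reduced.symm).dvd_of_dvd_mul_left h2
  refine ⟨q.num, fun i => ?_⟩
  have := hden i
  rw [hd1] at this
  simpa using this

end PartFour


section PartFive
open MvPolynomial

/-- a primitive generator of the relations between the weights -/
structure BBRel {n r : ℕ} (w : Fin n → (Fin r → ℤ)) (v : Fin n → ℕ) : Prop where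
  ne : v ≠ 0
  wt : bbWt w v = 0
  prim : ∀ m : ℕ, (∀ i, m ∣ v i) → m = 1
  ker : ∀ z : Fin n → ℤ, ∑ i, z i • w i = 0 → ∃ k : ℤ, ∀ i, z i = k * v i

theorem BBRel.coset {n r : ℕ} {w : Fin n → (Fin r → ℤ)} {v : Fin n → ℕ} (hv : BBRel w v)
    (T : Finset (Fin n → ℕ)) (hT : T.Nonempty) (t : Fin r → ℤ) (ht : ∀ c ∈ T, bbWt w c = t) :
    ∃ (c0 : Fin n → ℕ) (l : (Fin n → ℕ) → ℕ), ∀ c ∈ T, c = c0 + l c • v := by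
  classical
  obtain ⟨c0, hc0, hmin⟩ := T.exists_min_image (fun c => ∑ i, c i) hT
  have hpos : 0 < ∑ i, v i := by
    rw [Nat.pos_iff_ne_zero]
    intro h0
    apply hv.ne
    funext i
    exact (Finset.sum_eq_zero_iff.1 h0) i (Finset.mem_univ _)
  have hex : ∀ c ∈ T, ∃ l : ℕ, c = c0 + l • v := by
    intro c hc
    obtain ⟨k, hk⟩ := hv.ker (fun i => (c i : ℤ) - c0 i) (by
      have h1 := ht c hc
      rw [← ht c0 hc0] at h1
      unfold bbWt at h1
      simp only [sub_smul, Finset.sum_sub_distrib, natCast_zsmul]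
      rw [h1, sub_self])
    have hk0 : 0 ≤ k := by
      have h1 : (∑ i, c i : ℤ) - ∑ i, (c0 i : ℤ) = k * ∑ i, (v i : ℤ) := by
        rw [← Finset.sum_sub_distrib, Finset.mul_sum]
        exact Finset.sum_congr rfl fun i _ => hk i
      have h2 : ((∑ i, c0 i : ℕ) : ℤ) ≤ ((∑ i, c i : ℕ) : ℤ) := by exact_mod_cast hmin c hc
      push_cast at h2
      have h3 : (0 : ℤ) < ∑ i, (v i : ℤ) := by exact_mod_cast hpos
      by_contra hcon
      push Not at hcon
      nlinarith
    obtain ⟨l, rfl⟩ := Int.eq_ofNat_of_zero_le hk0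
    refine ⟨l, funext fun i => ?_⟩
    have := hk i
    simp only [Pi.add_apply, Pi.smul_apply, smul_eq_mul]
    have h4 : (c i : ℤ) = c0 i + l * v i := by linarith
    exact_mod_cast h4
  choose! l hl using hex
  exact ⟨c0, l, hl⟩

theorem bbMon_smul {A : Type*} [CommRing A] {n : ℕ} (f : Fin n → A) (v : Fin n → ℕ) (l : ℕ) :
    bbMon f (l • v) = bbMon f v ^ l := by
  simp [bbMon, ← Finset.prod_pow, pow_mul, mul_comm l]

theorem bb_unit_C {K : Type*} [Field K] {n : ℕ} {a : MvPolynomial (Fin n) K} (ha : IsUnit a) :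
    ∃ c : K, c ≠ 0 ∧ a = C c := by
  obtain ⟨c, hc, rfl⟩ := MvPolynomial.isUnit_iff_eq_C_of_isReduced.1 ha
  exact ⟨c, hc.ne_zero, rfl⟩

theorem bb_isUnit_C {K : Type*} [Field K] {n : ℕ} {c : K} (hc : c ≠ 0) :
    IsUnit (C c : MvPolynomial (Fin n) K) :=
  (IsUnit.mk0 c hc).map C

theorem bb_aeval_split {K : Type*} [Field K] [IsAlgClosed K] {n : ℕ} (b : MvPolynomial (Fin n) K)
    (G : Polynomial K) :
    Polynomial.aeval b G = C G.leadingCoeff * (G.roots.map fun c => b - C c).prod := by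
  conv_lhs => rw [(IsAlgClosed.splits G).eq_prod_roots]
  rw [map_mul, Polynomial.aeval_C, map_multiset_prod, Multiset.map_map]
  congr 2
  apply Multiset.map_congr rfl
  intro c _
  simp [MvPolynomial.algebraMap_eq]

theorem bb_dvd_split {K : Type*} [Field K] [IsAlgClosed K] {n : ℕ} {a b : MvPolynomial (Fin n) K}
    (ha : Prime a) {G : Polynomial K} (hG : G ≠ 0) (h : a ∣ Polynomial.aeval b G) :
    ∃ c ∈ G.roots, a ∣ b - C c := by
  rw [bb_aeval_split] at h
  rcases ha.dvd_or_dvd h with h1 | h1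
  · exact absurd (isUnit_of_dvd_unit h1 (bb_isUnit_C (Polynomial.leadingCoeff_ne_zero.2 hG))) ha.not_unit
  · obtain ⟨c, hc, h2⟩ := ha.exists_mem_multiset_map_dvd h1
    exact ⟨c, hc, h2⟩

variable {K : Type*} [Field K] {n r : ℕ}
    {Φ : MvPolynomial (Fin n) K →ₐ[K] AddMonoidAlgebra (MvPolynomial (Fin n) K) (Fin r → ℤ)}
    {o : Fin n → K} {f : Fin n → MvPolynomial (Fin n) K} {w : Fin n → (Fin r → ℤ)}
    {v : Fin n → ℕ}

theorem BBSys.mon_ne (h : BBSys Φ o f w) (c : Fin n → ℕ) : bbMon f c ≠ 0 :=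
  Finset.prod_ne_zero_iff.2 fun i _ => pow_ne_zero _ (h.irr i).ne_zero

theorem BBSys.mu_ev (h : BBSys Φ o f w) (hv : BBRel w v) : eval o (bbMon f v) = 0 := by
  obtain ⟨i, hi⟩ : ∃ i, v i ≠ 0 := by
    by_contra hcon
    push Not at hcon
    exact hv.ne (funext hcon)
  unfold bbMon
  rw [map_prod]
  apply Finset.prod_eq_zero (Finset.mem_univ i)
  rw [map_pow, h.ev, zero_pow hi]

theorem BBSys.mu_hom (h : BBSys Φ o f w) (hv : BBRel w v) : BBHom Φ 0 (bbMon f v) := by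
  have := h.hom_mon v
  rwa [hv.wt] at this

theorem BBSys.mu_sub_ne (h : BBSys Φ o f w) (hv : BBRel w v) (c : K) : bbMon f v - C c ≠ 0 := by
  intro h0
  have h1 := congrArg (eval o) h0
  rw [map_sub, h.mu_ev hv, eval_C, map_zero, zero_sub, neg_eq_zero] at h1
  rw [h1, C_0, sub_zero] at h0
  exact h.mon_ne v h0

theorem BBSys.mu_transc [IsAlgClosed K] (h : BBSys Φ o f w) (hv : BBRel w v) {G : Polynomial K}
    (hG : G ≠ 0) : Polynomial.aeval (bbMon f v) G ≠ 0 := by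
  rw [bb_aeval_split]
  refine mul_ne_zero (bb_isUnit_C (Polynomial.leadingCoeff_ne_zero.2 hG)).ne_zero ?_
  apply Multiset.prod_ne_zero
  intro h0
  obtain ⟨c, _, hc⟩ := Multiset.mem_map.1 h0
  exact h.mu_sub_ne hv c hc

theorem BBSys.relation (h : BBSys Φ o f w) {u : Fin r → ℤ} {b : MvPolynomial (Fin n) K}
    (hb : BBHom Φ u b) :
    ∃ (S : Finset (ℕ × (Fin n → ℕ))) (q : ℕ × (Fin n → ℕ) → K) (t : Fin r → ℤ), S.Nonempty ∧
      (∀ e ∈ S, q e ≠ 0) ∧ (∀ e ∈ S, e.1 • u + bbWt w e.2 = t) ∧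
      ∑ e ∈ S, q e • (b ^ e.1 * bbMon f e.2) = 0 := by
  classical
  let x : Option (Fin n) → MvPolynomial (Fin n) K := fun i => i.elim b f
  have hnot : ¬ AlgebraicIndependent K x := by
    intro hx
    have h1 := hx.lift_cardinalMk_le_trdeg
    rw [MvPolynomial.trdeg_of_isDomain] at h1
    simp only [Cardinal.mk_fintype, Fintype.card_option, Fintype.card_fin, Cardinal.lift_natCast] at h1
    have h2 : n + 1 ≤ n := by exact_mod_cast h1
    omega
  rw [algebraicIndependent_iff] at hnot
  push Not at hnot
  obtain ⟨p, hp, hp0⟩ := hnot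
  let E : (Option (Fin n) →₀ ℕ) ≃ ℕ × (Fin n → ℕ) :=
    Finsupp.equivFunOnFinite.trans Equiv.piOptionEquivProd
  obtain ⟨e0, he0⟩ := MvPolynomial.support_nonempty.2 hp0
  let wt : ℕ × (Fin n → ℕ) → (Fin r → ℤ) := fun e => e.1 • u + bbWt w e.2
  let S0 : Finset (ℕ × (Fin n → ℕ)) := p.support.map E.toEmbedding
  let q : ℕ × (Fin n → ℕ) → K := fun e => p.coeff (E.symm e)
  have hsum : ∑ e ∈ S0, q e • (b ^ e.1 * bbMon f e.2) = 0 := by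
    rw [← hp, MvPolynomial.aeval_def, MvPolynomial.eval₂_eq', Finset.sum_map]
    apply Finset.sum_congr rfl
    intro e _
    rw [Algebra.smul_def]
    congr 1
    · simp [q]
    · rw [Fintype.prod_option]
      rfl
  have hhom : ∀ e, BBHom Φ (wt e) (q e • (b ^ e.1 * bbMon f e.2)) := fun e =>
    ((hb.pow e.1).mul (h.hom_mon e.2)).smul _
  refine ⟨S0.filter (fun e => wt e = wt (E e0)), q, wt (E e0), ⟨E e0, ?_⟩, ?_, ?_, ?_⟩
  · rw [Finset.mem_filter]
    exact ⟨Finset.mem_map_of_mem _ he0, rfl⟩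
  · intro e he
    rw [Finset.mem_filter, Finset.mem_map] at he
    obtain ⟨⟨e', he', rfl⟩, _⟩ := he
    simpa [q] using he'
  · intro e he
    exact (Finset.mem_filter.1 he).2
  · have h1 := congrArg (fun a => (Φ a).coeff (wt (E e0))) hsum
    simp only [map_sum, map_zero, AddMonoidAlgebra.coeff_sum, Finsupp.finset_sum_apply,
      AddMonoidAlgebra.coeff_zero, Finsupp.zero_apply] at h1
    rw [Finset.sum_filter]
    refine Eq.trans ?_ h1
    apply Finset.sum_congr rfl
    intro e _
    split_ifs with hw
    · rw [← hw, (hhom e).coeff_self]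
    · rw [(hhom e).coeff_ne (Ne.symm hw)]

theorem BBSys.dvd_mon (h : BBSys Φ o f w) (hv : BBRel w v) {u : Fin r → ℤ}
    {b : MvPolynomial (Fin n) K} (hb : BBHom Φ u b) (hb0 : b ≠ 0) :
    ∃ (c : Fin n → ℕ) (G : Polynomial K), G ≠ 0 ∧ b ∣ bbMon f c * Polynomial.aeval (bbMon f v) G := by
  classical
  obtain ⟨S, q, t, hS, hq, ht, hsum⟩ := h.relation hb
  obtain ⟨e0, he0, hmin⟩ := S.exists_min_image (fun e => e.1) hS
  have hsum' : ∑ e ∈ S, q e • (b ^ (e.1 - e0.1) * bbMon f e.2) = 0 := by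
    have h1 : b ^ e0.1 * ∑ e ∈ S, q e • (b ^ (e.1 - e0.1) * bbMon f e.2) = 0 := by
      rw [← hsum, Finset.mul_sum]
      apply Finset.sum_congr rfl
      intro e he
      rw [mul_smul_comm, ← mul_assoc, ← pow_add, Nat.add_sub_cancel' (hmin e he)]
    exact (mul_eq_zero.1 h1).resolve_left (pow_ne_zero _ hb0)
  let S1 := S.filter fun e => e.1 = e0.1
  have hdvd : b ∣ ∑ e ∈ S1, q e • bbMon f e.2 := by
    rw [← Finset.sum_filter_add_sum_filter_not S (fun e => e.1 = e0.1)] at hsum'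
    have h1 : ∑ e ∈ S1, q e • (b ^ (e.1 - e0.1) * bbMon f e.2) = ∑ e ∈ S1, q e • bbMon f e.2 := by
      apply Finset.sum_congr rfl
      intro e he
      rw [(Finset.mem_filter.1 he).2, Nat.sub_self, pow_zero, one_mul]
    rw [h1] at hsum'
    rw [eq_neg_of_add_eq_zero_left hsum', dvd_neg]
    apply Finset.dvd_sum
    intro e he
    rw [Finset.mem_filter] at he
    have h2 := hmin e he.1
    obtain ⟨k, hk⟩ : ∃ k, e.1 - e0.1 = k + 1 := ⟨e.1 - e0.1 - 1, by omega⟩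
    rw [hk, pow_succ, Algebra.smul_def]
    exact ⟨algebraMap K _ (q e) * (b ^ k * bbMon f e.2), by ring⟩
  obtain ⟨c0, l, hl⟩ := hv.coset (S1.image Prod.snd) ⟨e0.2, Finset.mem_image_of_mem _
    (Finset.mem_filter.2 ⟨he0, rfl⟩)⟩ (t - e0.1 • u) (by
      intro c hc
      obtain ⟨e, he, rfl⟩ := Finset.mem_image.1 hc
      have h1 := Finset.mem_filter.1 he
      have h2 := ht e h1.1
      rw [h1.2] at h2
      rw [← h2, add_sub_cancel_left])
  have hl' : ∀ e ∈ S1, e.2 = c0 + l e.2 • v := fun e he => hl _ (Finset.mem_image_of_mem _ he)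
  refine ⟨c0, ∑ e ∈ S1, Polynomial.monomial (l e.2) (q e), ?_, ?_⟩
  · intro h0
    have h1 := congrArg (fun p => Polynomial.coeff p (l e0.2)) h0
    simp only [Polynomial.finset_sum_coeff, Polynomial.coeff_monomial, Polynomial.coeff_zero] at h1
    rw [Finset.sum_eq_single e0] at h1
    · rw [if_pos rfl] at h1
      exact hq e0 he0 h1
    · intro e he hne
      rw [if_neg]
      intro hle
      apply hne
      refine Prod.ext (Finset.mem_filter.1 he).2 ?_
      rw [hl' e he, hl' e0 (Finset.mem_filter.2 ⟨he0, rfl⟩), hle]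
    · intro hcon
      exact absurd (show e0 ∈ S1 from Finset.mem_filter.2 ⟨he0, rfl⟩) hcon
  · convert hdvd using 1
    rw [map_sum, Finset.mul_sum]
    apply Finset.sum_congr rfl
    intro e he
    conv_rhs => rw [hl' e he]
    rw [bbMon_add, bbMon_smul, Polynomial.aeval_monomial, Algebra.smul_def]
    ring

theorem BBSys.alg_rel (h : BBSys Φ o f w) (hv : BBRel w v)
    {b : MvPolynomial (Fin n) K} (hb : BBHom Φ 0 b) :
    ∃ F : Polynomial (Polynomial K), F ≠ 0 ∧
      F.eval₂ (Polynomial.aeval (bbMon f v) : Polynomial K →ₐ[K] MvPolynomial (Fin n) K).toRingHom b = 0 := by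
  classical
  obtain ⟨S, q, t, hS, hq, ht, hsum⟩ := h.relation hb
  obtain ⟨e0, he0⟩ := hS
  obtain ⟨c0, l, hl⟩ := hv.coset (S.image Prod.snd) ⟨e0.2, Finset.mem_image_of_mem _ he0⟩ t (by
      intro c hc
      obtain ⟨e, he, rfl⟩ := Finset.mem_image.1 hc
      have h2 := ht e he
      rwa [smul_zero, zero_add] at h2)
  have hl' : ∀ e ∈ S, e.2 = c0 + l e.2 • v := fun e he => hl _ (Finset.mem_image_of_mem _ he)
  refine ⟨∑ e ∈ S, Polynomial.monomial e.1 (Polynomial.monomial (l e.2) (q e)), ?_, ?_⟩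
  · intro h0
    have h1 := congrArg (fun p => Polynomial.coeff (Polynomial.coeff p e0.1) (l e0.2)) h0
    simp only [Polynomial.finset_sum_coeff, Polynomial.coeff_monomial, Polynomial.coeff_zero] at h1
    rw [Finset.sum_eq_single e0] at h1
    · simp only [if_true, Polynomial.coeff_monomial] at h1
      exact hq e0 he0 h1
    · intro e he hne
      split_ifs with h2
      · rw [Polynomial.coeff_monomial, if_neg]
        intro hle
        apply hne
        refine Prod.ext h2 ?_
        rw [hl' e he, hl' e0 he0, hle]
      · simp
    · intro hcon
      exact absurd he0 hcon
  · have h1 : bbMon f c0 * ∑ e ∈ S, q e • (b ^ e.1 * bbMon f v ^ l e.2) = 0 := by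
      rw [← hsum, Finset.mul_sum]
      apply Finset.sum_congr rfl
      intro e he
      conv_rhs => rw [hl' e he]
      rw [bbMon_add, bbMon_smul, mul_smul_comm]
      congr 1
      ring
    have h2 := (mul_eq_zero.1 h1).resolve_left (h.mon_ne c0)
    rw [← h2, Polynomial.eval₂_finset_sum]
    apply Finset.sum_congr rfl
    intro e _
    rw [Polynomial.eval₂_monomial, AlgHom.toRingHom_eq_coe, RingHom.coe_coe, Polynomial.aeval_monomial,
      Algebra.smul_def]
    ring

theorem BBSys.dvd_weight_zero (h : BBSys Φ o f w) {p g : MvPolynomial (Fin n) K}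
    (hg : BBHom Φ 0 g) (hgo : eval o g ≠ 0) (hp : p ∣ g) : BBHom Φ 0 p := by
  have hg0 : g ≠ 0 := by rintro rfl; simp at hgo
  obtain ⟨u, hu⟩ := h.gr.of_dvd hg hg0 hp
  by_cases h0 : u = 0
  · rwa [h0] at hu
  · exfalso
    obtain ⟨s, rfl⟩ := hp
    apply hgo
    rw [map_mul, h.fix u p hu h0, zero_mul]

theorem BBSys.exists_dvd_sub [IsAlgClosed K] (h : BBSys Φ o f w) (hv : BBRel w v)
    {a b : MvPolynomial (Fin n) K} (ha : Prime a) (haμ : a ∣ bbMon f v - 1) (hb : BBHom Φ 0 b) :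
    ∃ c : K, a ∣ b - C c := by
  classical
  obtain ⟨F, hF0, hF⟩ := h.alg_rel hv hb
  letI : NormalizedGCDMonoid (Polynomial K) := Classical.choice inferInstance
  rw [F.eq_C_content_mul_primPart, Polynomial.eval₂_mul, Polynomial.eval₂_C] at hF
  have hc : F.content ≠ 0 := fun h0 => hF0 (Polynomial.content_eq_zero_iff.1 h0)
  have hF' := (mul_eq_zero.1 hF).resolve_left (h.mu_transc hv hc)
  set P := F.primPart with hP
  let G := P.map (Polynomial.evalRingHom (1 : K))
  have hG : G ≠ 0 := by
    intro h0
    have h1 : Polynomial.C (Polynomial.X - Polynomial.C (1 : K)) ∣ P := by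
      rw [Polynomial.C_dvd_iff_dvd_coeff]
      intro i
      rw [Polynomial.dvd_iff_isRoot]
      have := congrArg (fun p => Polynomial.coeff p i) h0
      simpa [G, Polynomial.coeff_map] using this
    have h2 := F.isPrimitive_primPart _ h1
    exact Polynomial.not_isUnit_X_sub_C 1 h2
  have hdvd : a ∣ Polynomial.aeval b G := by
    rw [← Ideal.mem_span_singleton, ← Ideal.Quotient.eq_zero_iff_mem]
    let π := Ideal.Quotient.mk (Ideal.span {a})
    have h1 := congrArg π hF'
    rw [map_zero, Polynomial.hom_eval₂] at h1
    rw [← h1, Polynomial.aeval_def, Polynomial.hom_eval₂, Polynomial.eval₂_map]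
    congr 1
    apply Polynomial.ringHom_ext
    · intro c
      simp [π]
    · simp only [RingHom.comp_apply, AlgHom.toRingHom_eq_coe, RingHom.coe_coe, Polynomial.aeval_X,
        Polynomial.coe_evalRingHom, Polynomial.eval_X, map_one]
      symm
      have : π (bbMon f v - 1) = 0 := by
        rw [Ideal.Quotient.eq_zero_iff_mem, Ideal.mem_span_singleton]; exact haμ
      rw [map_sub, map_one, sub_eq_zero] at this
      exact this
  obtain ⟨c, _, hc⟩ := bb_dvd_split ha hG hdvd
  exact ⟨c, hc⟩

theorem BBSys.weight_zero_range [IsAlgClosed K] (h : BBSys Φ o f w) (hv : BBRel w v)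
    {a : MvPolynomial (Fin n) K} (ha : Prime a) (haμ : a ∣ bbMon f v - 1) (ha0 : BBHom Φ 0 a)
    (N : ℕ) : ∀ b : MvPolynomial (Fin n) K, b.totalDegree < N → BBHom Φ 0 b →
      ∃ G : Polynomial K, Polynomial.aeval a G = b := by
  induction N with
  | zero => intro b hb; omega
  | succ N ih =>
    intro b hb hb0
    obtain ⟨c, b', hb'⟩ := h.exists_dvd_sub hv ha haμ hb0
    by_cases h0 : b' = 0
    · refine ⟨Polynomial.C c, ?_⟩
      rw [h0, mul_zero, sub_eq_zero] at hb'
      rw [hb', Polynomial.aeval_C, MvPolynomial.algebraMap_eq]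
    · have hab : a * b' ≠ 0 := mul_ne_zero ha.ne_zero h0
      have hh : BBHom Φ 0 (a * b') := by rw [← hb']; exact hb0.sub (bbHom_C c)
      have hh' : BBHom Φ 0 b' := by simpa using h.gr.quot ha0 hh hab
      have hd : a.totalDegree ≠ 0 := by
        intro hd
        rw [MvPolynomial.totalDegree_eq_zero_iff_eq_C] at hd
        by_cases hc : coeff 0 a = 0
        · rw [hc, C_0] at hd; exact ha.ne_zero hd
        · apply ha.not_unit; rw [hd]; exact bb_isUnit_C hc
      have h1 := MvPolynomial.totalDegree_mul_of_isDomain ha.ne_zero h0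
      have h2 := MvPolynomial.totalDegree_sub_C_le b c
      rw [hb', h1] at h2
      obtain ⟨G, hG⟩ := ih b' (by omega) hh'
      refine ⟨Polynomial.C c + Polynomial.X * G, ?_⟩
      rw [map_add, map_mul, Polynomial.aeval_C, Polynomial.aeval_X, hG, ← hb', MvPolynomial.algebraMap_eq]
      ring

theorem BBSys.prime (h : BBSys Φ o f w) (i : Fin n) : Prime (f i) := (h.irr i).prime

theorem BBSys.dvd_mon_prime (h : BBSys Φ o f w) {p : MvPolynomial (Fin n) K} (hp : Prime p)
    {c : Fin n → ℕ} (hd : p ∣ bbMon f c) : ∃ (i : Fin n) (s : K), s ≠ 0 ∧ p = C s * f i := by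
  obtain ⟨i, _, hi⟩ := hp.exists_mem_finset_dvd hd
  have h1 := (hp.irreducible.dvd_irreducible_iff_associated (h.irr i)).1 (hp.dvd_of_dvd_pow hi)
  obtain ⟨s, hs⟩ := h1.symm
  obtain ⟨t, ht, ht'⟩ := bb_unit_C s.isUnit
  exact ⟨i, t, ht, by rw [← hs, ht', mul_comm]⟩

theorem BBSys.not_dvd (h : BBSys Φ o f w) {i j : Fin n} (hij : i ≠ j) : ¬ f i ∣ f j := by
  intro hd
  have h1 := ((h.irr i).dvd_irreducible_iff_associated (h.irr j)).1 hd
  obtain ⟨s, hs⟩ := h1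
  obtain ⟨t, ht, ht'⟩ := bb_unit_C s.isUnit
  have h2 : bbD o (f j) = t • bbD o (f i) := by
    rw [← hs, ht', bbD_mul, bbD_C, smul_zero, zero_add, eval_C]
  have h3 := linearIndependent_iff'.1 h.li {i, j} (fun k => if k = i then t else -1) (by
    rw [Finset.sum_pair hij, if_pos rfl, if_neg hij.symm, h2]
    simp) j (by simp)
  rw [if_neg hij.symm] at h3
  simp at h3

theorem BBSys.emult (h : BBSys Φ o f w) (j : Fin n) (c : Fin n → ℕ) :
    emultiplicity (f j) (bbMon f c) = c j := by
  classical
  unfold bbMon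
  rw [Finset.emultiplicity_prod (h.prime j), Finset.sum_eq_single j]
  · rw [emultiplicity_pow (h.prime j), FiniteMultiplicity.emultiplicity_self, mul_one]
    exact FiniteMultiplicity.of_prime_left (h.prime j) (h.prime j).ne_zero
  · intro i _ hi
    rw [emultiplicity_pow (h.prime j), emultiplicity_eq_zero.2 (h.not_dvd hi.symm), mul_zero]
  · intro hcon; exact absurd (Finset.mem_univ _) hcon

theorem BBSys.weight_zero_mem [IsAlgClosed K] (h : BBSys Φ o f w) (hv : BBRel w v)
    {b : MvPolynomial (Fin n) K} (hb : BBHom Φ 0 b) : b ∈ Algebra.adjoin K (Set.range f) := by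
  classical
  have hμ1 : bbMon f v - 1 ≠ 0 := by simpa using h.mu_sub_ne hv 1
  have hev1 : eval o (bbMon f v - 1) ≠ 0 := by
    rw [map_sub, h.mu_ev hv, map_one]; simp
  have hnu : ¬ IsUnit (bbMon f v - 1) := by
    intro hu
    obtain ⟨c, hc, hc'⟩ := bb_unit_C hu
    apply h.mu_sub_ne hv (c + 1)
    rw [C_add, C_1, ← hc']; ring
  obtain ⟨a, hai, haμ⟩ := WfDvdMonoid.exists_irreducible_factor hnu hμ1
  have ha : Prime a := hai.prime
  have ha0 : BBHom Φ 0 a := h.dvd_weight_zero ((h.mu_hom hv).sub BBHom.one) hev1 haμ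
  have hrange : ∀ b, BBHom Φ 0 b → ∃ G : Polynomial K, Polynomial.aeval a G = b := fun b hb =>
    h.weight_zero_range hv ha haμ ha0 _ b (Nat.lt_succ_self _) hb
  obtain ⟨H, hH⟩ := hrange _ (h.mu_hom hv)
  have hH0 : H ≠ 0 := by
    rintro rfl; rw [map_zero] at hH; exact h.mon_ne v hH.symm
  have hsub : ∀ c, a - C c ≠ 0 ∧ ¬ IsUnit (a - C c) := by
    have hnc : ∀ c, a ≠ C c := by
      rintro c rfl
      by_cases hc : c = 0
      · subst hc; exact ha.ne_zero C_0
      · exact ha.not_unit (bb_isUnit_C hc)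
    intro c
    refine ⟨sub_ne_zero.2 (hnc c), fun hu => ?_⟩
    obtain ⟨c', _, hc'⟩ := bb_unit_C hu
    apply hnc (c' + c)
    rw [C_add, ← hc']; ring
  have hroot : ∀ c ∈ H.roots, c = eval o a := by
    intro c hc
    have hd : a - C c ∣ bbMon f v := by
      obtain ⟨Q, hQ⟩ := Polynomial.dvd_iff_isRoot.2 (Polynomial.isRoot_of_mem_roots hc)
      rw [← hH, hQ, map_mul, map_sub, Polynomial.aeval_X, Polynomial.aeval_C,
        MvPolynomial.algebraMap_eq]
      exact dvd_mul_right _ _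
    obtain ⟨p, hpi, hp⟩ := WfDvdMonoid.exists_irreducible_factor (hsub c).2 (hsub c).1
    obtain ⟨i, s, _, hs⟩ := h.dvd_mon_prime hpi.prime (hp.trans hd)
    obtain ⟨t, ht⟩ := hp
    have h1 := congrArg (eval o) ht
    rw [hs, map_mul, map_mul, h.ev, mul_zero, zero_mul, map_sub, eval_C, sub_eq_zero] at h1
    exact h1.symm
  have hrep : H.roots = Multiset.replicate (Multiset.card H.roots) (eval o a) :=
    Multiset.eq_replicate.2 ⟨rfl, hroot⟩
  set m := Multiset.card H.roots with hm
  have hμ : bbMon f v = C H.leadingCoeff * (a - C (eval o a)) ^ m := by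
    rw [← hH, bb_aeval_split, hrep, Multiset.map_replicate, Multiset.prod_replicate]
  have hlc : H.leadingCoeff ≠ 0 := Polynomial.leadingCoeff_ne_zero.2 hH0
  have hm1 : m = 1 := by
    apply hv.prim
    intro j
    have h1 := h.emult j v
    rw [hμ, emultiplicity_mul (h.prime j), emultiplicity_pow (h.prime j)] at h1
    have h2 : emultiplicity (f j) (C H.leadingCoeff) = 0 := by
      rw [emultiplicity_eq_zero]
      intro hd
      exact (h.prime j).not_unit (isUnit_of_dvd_unit hd (bb_isUnit_C hlc))
    rw [h2, zero_add, FiniteMultiplicity.emultiplicity_eq_multiplicity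
      (FiniteMultiplicity.of_prime_left (h.prime j) (hsub _).1)] at h1
    exact ⟨_, by exact_mod_cast h1.symm⟩
  rw [hm1, pow_one] at hμ
  have hmon : bbMon f v ∈ Algebra.adjoin K (Set.range f) := by
    unfold bbMon
    exact prod_mem fun i _ => pow_mem (Algebra.subset_adjoin (Set.mem_range_self i)) _
  have hCmem : ∀ c : K, (C c : MvPolynomial (Fin n) K) ∈ Algebra.adjoin K (Set.range f) := fun c =>
    Subalgebra.algebraMap_mem _ c
  have hamem : a ∈ Algebra.adjoin K (Set.range f) := by
    have : a = C H.leadingCoeff⁻¹ * bbMon f v + C (eval o a) := by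
      rw [hμ, ← mul_assoc, ← C_mul, inv_mul_cancel₀ hlc, C_1, one_mul, sub_add_cancel]
    rw [this]
    exact add_mem (mul_mem (hCmem _) hmon) (hCmem _)
  obtain ⟨G, rfl⟩ := hrange b hb
  have := Polynomial.aeval_mem_adjoin_singleton (R := K) (p := G) a
  exact Algebra.adjoin_le (Set.singleton_subset_iff.2 hamem) this

theorem BBSys.caseB [IsAlgClosed K] (h : BBSys Φ o f w) (hv : BBRel w v)
    {u : Fin r → ℤ} {a : MvPolynomial (Fin n) K} (hu : BBHom Φ u a) :
    a ∈ Algebra.adjoin K (Set.range f) := by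
  classical
  have hCmem : ∀ c : K, (C c : MvPolynomial (Fin n) K) ∈ Algebra.adjoin K (Set.range f) := fun c =>
    Subalgebra.algebraMap_mem _ c
  have hirr : ∀ u p, Irreducible p → BBHom Φ u p → p ∈ Algebra.adjoin K (Set.range f) := by
    intro u p hp hpu
    have hmon : ∀ c, p ∣ bbMon f c → p ∈ Algebra.adjoin K (Set.range f) := by
      intro c hc
      obtain ⟨i, s, _, hs⟩ := h.dvd_mon_prime hp.prime hc
      rw [hs]
      exact mul_mem (hCmem s) (Algebra.subset_adjoin (Set.mem_range_self i))
    obtain ⟨c, G, hG, hd⟩ := h.dvd_mon hv hpu hp.ne_zero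
    rcases hp.prime.dvd_or_dvd hd with h1 | h1
    · exact hmon c h1
    · obtain ⟨s, _, hs⟩ := bb_dvd_split hp.prime hG h1
      by_cases hs0 : s = 0
      · rw [hs0, C_0, sub_zero] at hs
        exact hmon v hs
      · apply h.weight_zero_mem hv
        refine h.dvd_weight_zero ((h.mu_hom hv).sub (bbHom_C s)) ?_ hs
        rw [map_sub, h.mu_ev hv, eval_C, zero_sub, neg_ne_zero]
        exact hs0
  induction a using WfDvdMonoid.induction_on_irreducible generalizing u with
  | zero => exact zero_mem _
  | unit x hx =>
    obtain ⟨c, _, rfl⟩ := bb_unit_C hx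
    exact hCmem c
  | mul a p ha hp ih =>
    have h0 : p * a ≠ 0 := mul_ne_zero hp.ne_zero ha
    obtain ⟨u1, h1⟩ := h.gr.factor hu h0
    obtain ⟨u2, h2⟩ := h.gr.factor (a := a) (b := p) (by rwa [mul_comm]) (by rwa [mul_comm])
    exact mul_mem (hirr u1 p hp h1) (ih h2)

end PartFive

section PartSix
open MvPolynomial

variable {K : Type*} [Field K] {n r : ℕ}

/-- the character of weight `m` -/
noncomputable def bbChar (K : Type*) [Field K] {r : ℕ} (m : Fin r → ℤ) : (Fin r → Kˣ) →* K where
  toFun t := ∏ j, ((t j ^ m j : Kˣ) : K)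
  map_one' := by simp
  map_mul' := by
    intro s t
    simp [mul_zpow, Finset.prod_mul_distrib]

/-- evaluation of characters at `t` -/
noncomputable def bbEv (t : Fin r → Kˣ) : Multiplicative (Fin r → ℤ) →* K where
  toFun m := bbChar K m.toAdd t
  map_one' := by simp [bbChar]
  map_mul' := by
    intro a b
    simp [bbChar, zpow_add, Finset.prod_mul_distrib]

theorem bb_prod_zpow {G ι : Type*} [CommGroup G] (s : G) (S : Finset ι) (k : ι → ℤ) :
    ∏ j ∈ S, s ^ k j = s ^ ∑ j ∈ S, k j := by
  classical
  induction S using Finset.induction_on with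
  | empty => simp
  | insert i S hi ih => rw [Finset.prod_insert hi, Finset.sum_insert hi, ih, zpow_add]

theorem bb_exists_zpow_ne [IsAlgClosed K] (k : ℤ) (hk : k ≠ 0) : ∃ s : Kˣ, s ^ k ≠ 1 := by
  have hinf : Infinite K := IsAlgClosed.instInfinite
  have hp : (Polynomial.X * (Polynomial.X ^ k.natAbs - 1) : Polynomial K) ≠ 0 := by
    refine mul_ne_zero Polynomial.X_ne_zero ?_
    have := Polynomial.X_pow_sub_C_ne_zero (R := K) (Int.natAbs_pos.2 hk) 1
    simpa using this
  obtain ⟨s, hs⟩ : ∃ s, Polynomial.eval s (Polynomial.X * (Polynomial.X ^ k.natAbs - 1) : Polynomial K) ≠ 0 := by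
    by_contra hcon
    push Not at hcon
    exact hp (Polynomial.funext fun s => by rw [hcon, Polynomial.eval_zero])
  simp only [Polynomial.eval_mul, Polynomial.eval_X, Polynomial.eval_sub, Polynomial.eval_pow,
    Polynomial.eval_one] at hs
  have hs0 := left_ne_zero_of_mul hs
  have hs1 : s ^ k.natAbs ≠ 1 := fun h => right_ne_zero_of_mul hs (by rw [h, sub_self])
  refine ⟨Units.mk0 s hs0, fun h => hs1 ?_⟩
  have h2 : (Units.mk0 s hs0) ^ k.natAbs = 1 := by
    rcases Int.natAbs_eq k with h3 | h3
    · rw [h3, zpow_natCast] at h; exact h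
    · rw [h3, zpow_neg, zpow_natCast, inv_eq_one] at h; exact h
  have := congrArg Units.val h2
  simpa using this

theorem bbChar_injective [IsAlgClosed K] : Function.Injective (bbChar K (r := r)) := by
  classical
  intro m m' h
  by_contra hne
  obtain ⟨j, hj⟩ := Function.ne_iff.1 hne
  obtain ⟨s, hs⟩ := bb_exists_zpow_ne (K := K) (m j - m' j) (sub_ne_zero.2 hj)
  have h1 : bbChar K m (Pi.mulSingle j s) = bbChar K m' (Pi.mulSingle j s) := by rw [h]
  have h2 : ∀ m : Fin r → ℤ, bbChar K m (Pi.mulSingle j s) = ((s ^ m j : Kˣ) : K) := by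
    intro m
    change ∏ i, (((Pi.mulSingle j s : Fin r → Kˣ) i ^ m i : Kˣ) : K) = _
    rw [Finset.prod_eq_single j]
    · rw [Pi.mulSingle_eq_same]
    · intro i _ hi
      rw [Pi.mulSingle_eq_of_ne hi, one_zpow, Units.val_one]
    · intro hcon; exact absurd (Finset.mem_univ _) hcon
  rw [h2, h2] at h1
  apply hs
  rw [zpow_sub, Units.ext h1, mul_inv_cancel]

theorem bb_char_indep [IsAlgClosed K] (S : Finset (Fin r → ℤ)) (g : (Fin r → ℤ) → MvPolynomial (Fin n) K)
    (h : ∀ t : Fin r → Kˣ, ∑ m ∈ S, bbChar K m t • g m = 0) : ∀ m ∈ S, g m = 0 := by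
  intro m hm
  have hli := (linearIndependent_monoidHom (Fin r → Kˣ) K).comp (bbChar K (r := r)) bbChar_injective
  ext d
  rw [coeff_zero]
  refine linearIndependent_iff'.1 hli S (fun m => coeff d (g m)) ?_ m hm
  funext t
  have h1 := congrArg (coeff d) (h t)
  rw [coeff_sum, coeff_zero] at h1
  simp only [Finset.sum_apply, Pi.smul_apply, Function.comp_apply, smul_eq_mul, Pi.zero_apply]
  rw [← h1]
  apply Finset.sum_congr rfl
  intro m _
  rw [coeff_smul, smul_eq_mul, mul_comm]

variable {Φ : MvPolynomial (Fin n) K →ₐ[K] AddMonoidAlgebra (MvPolynomial (Fin n) K) (Fin r → ℤ)}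

theorem bbTwist_sum (Φ : MvPolynomial (Fin n) K →ₐ[K] AddMonoidAlgebra (MvPolynomial (Fin n) K) (Fin r → ℤ))
    (t : Fin r → Kˣ) (a : MvPolynomial (Fin n) K) :
    bbTwist Φ (bbEv t) a = ∑ m ∈ (Φ a).coeff.support, bbChar K m t • (Φ a).coeff m := by
  classical
  rw [bbTwist, AlgHom.comp_apply]
  generalize Φ a = x
  change _ = x.coeff.sum fun m b => bbChar K m t • b
  induction x using AddMonoidAlgebra.induction_linear with
  | zero => simp
  | add x y hx hy =>
    rw [map_add, hx, hy, AddMonoidAlgebra.coeff_add, Finsupp.sum_add_index']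
    · intro m; simp
    · intro m b c; rw [smul_add]
  | single m b =>
    simp [AddMonoidAlgebra.liftNCAlgHom, AddMonoidAlgebra.liftNCRingHom, Algebra.smul_def, mul_comm, bbEv]

theorem bb_gr_of_action [IsAlgClosed K] (σ : (Fin r → Kˣ) → (Fin n → K) → (Fin n → K))
    (hid : ∀ x, σ 1 x = x) (hcomp : ∀ t₁ t₂ x, σ t₁ (σ t₂ x) = σ (t₁ * t₂) x)
    (hev : ∀ t x a, eval x (bbTwist Φ (bbEv t) a) = eval (σ t x) a) : BBGr Φ := by
  classical
  have hinf : Infinite K := IsAlgClosed.instInfinite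
  have htw : ∀ s t a, bbTwist Φ (bbEv s) (bbTwist Φ (bbEv t) a) = bbTwist Φ (bbEv (t * s)) a := by
    intro s t a
    apply MvPolynomial.funext
    intro x
    rw [hev, hev, hev, hcomp]
  constructor
  · intro a
    change ∑ m ∈ (Φ a).coeff.support, (Φ a).coeff m = a
    have h1 : bbTwist Φ (bbEv 1) a = a := by
      apply MvPolynomial.funext
      intro x
      rw [hev, hid]
    rw [bbTwist_sum] at h1
    simpa only [map_one, one_smul] using h1
  · intro a m
    by_cases hm : m ∈ (Φ a).coeff.support
    swap
    · rw [Finsupp.notMem_support_iff.1 hm]; simp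
    have h1 : ∀ s, bbTwist Φ (bbEv s) ((Φ a).coeff m) = bbChar K m s • (Φ a).coeff m := by
      intro s
      rw [← sub_eq_zero]
      refine bb_char_indep (Φ a).coeff.support (fun m => bbTwist Φ (bbEv s) ((Φ a).coeff m) -
        bbChar K m s • (Φ a).coeff m) ?_ m hm
      intro t
      have h2 := htw s t a
      rw [bbTwist_sum Φ t a, bbTwist_sum Φ (t * s) a, map_sum, ← sub_eq_zero, ← Finset.sum_sub_distrib] at h2
      rw [← h2]
      apply Finset.sum_congr rfl
      intro m' _
      rw [map_smul, map_mul, smul_sub, mul_smul]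
    generalize (Φ a).coeff m = b at h1
    let S := insert m (Φ b).coeff.support
    have h2 : ∀ u ∈ S, (Φ b).coeff u - (if u = m then b else 0) = 0 := by
      refine bb_char_indep S (fun u => (Φ b).coeff u - (if u = m then b else 0)) ?_
      intro s
      have h3 := h1 s
      rw [bbTwist_sum] at h3
      simp only [smul_sub, Finset.sum_sub_distrib, smul_ite, smul_zero, Finset.sum_ite_eq']
      rw [if_pos (Finset.mem_insert_self _ _), ← h3, sub_eq_zero]
      symm
      apply Finset.sum_subset (Finset.subset_insert _ _)
      intro u _ hu
      rw [Finsupp.notMem_support_iff.1 hu, smul_zero]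
    ext u : 2
    by_cases hu : u ∈ S
    · have h3 := sub_eq_zero.1 (h2 u hu)
      rw [h3]
      by_cases hum : u = m
      · subst hum; simp
      · simp [hum, Ne.symm hum]
    · have h3 : u ∉ (Φ b).coeff.support := fun h => hu (Finset.mem_insert_of_mem h)
      have h4 : u ≠ m := fun h => hu (by rw [h]; exact Finset.mem_insert_self _ _)
      rw [Finsupp.notMem_support_iff.1 h3]
      simp [h4.symm]

theorem bb_generators [IsAlgClosed K] (hr : r = n - 1) (h : BBGr Φ)
    (hE : ∀ l : Fin r → ℤ, l ≠ 0 → ∃ u a, BBHom Φ u a ∧ a ≠ 0 ∧ ∑ j, l j * u j ≠ 0) :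
    ∃ (f : Fin n → MvPolynomial (Fin n) K) (w : Fin n → (Fin r → ℤ)), (∀ i, BBHom Φ (w i) (f i)) ∧
      Algebra.adjoin K (Set.range f) = ⊤ := by
  classical
  obtain ⟨o, ho⟩ := bb_exists_fixed h
  obtain ⟨f, w, h1, h2, h3, h4⟩ := h.exists_basis ho
  have hs : BBSys Φ o f w := ⟨h, ho, h1, h2, h3, h4⟩
  refine ⟨f, w, h1, ?_⟩
  suffices hmem : ∀ u a, BBHom Φ u a → a ∈ Algebra.adjoin K (Set.range f) by
    rw [eq_top_iff]
    intro a _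
    exact h.induction (P := fun a => a ∈ Algebra.adjoin K (Set.range f)) (zero_mem _)
      (fun a b ha hb => add_mem ha hb) hmem a
  by_cases hA : ∀ c, bbWt w c = 0 → c = 0
  · intro u a ha
    exact hs.caseA hA ha
  · push Not at hA
    obtain ⟨v0, hv0, hv0'⟩ := hA
    have hw : ∀ l : Fin r → ℤ, l ≠ 0 → ∃ i, ∑ j, l j * w i j ≠ 0 := by
      intro l hl
      obtain ⟨u, a, hua, ha0, hlu⟩ := hE l hl
      by_contra hcon
      push Not at hcon
      obtain ⟨c, _, rfl⟩ := hs.exists_mon 0 hua (by simp) ha0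
      apply hlu
      unfold bbWt
      have : ∑ j, l j * (∑ i, c i • w i) j = ∑ i, (c i : ℤ) * ∑ j, l j * w i j := by
        simp only [Finset.sum_apply, Pi.smul_apply, Finset.mul_sum]
        rw [Finset.sum_comm]
        refine Finset.sum_congr rfl fun i _ => Finset.sum_congr rfl fun j _ => ?_
        rw [nsmul_eq_mul]
        ring
      rw [this]
      simp [hcon]
    obtain ⟨v, hv1, hv2, hv3, hv4⟩ := bb_kernel hr w hw v0 hv0' hv0
    intro u a ha
    exact hs.caseB ⟨hv1, hv2, hv3, hv4⟩ ha

theorem bb_coaction {σ : (Fin r → Kˣ) → (Fin n → K) → (Fin n → K)} (hreg : IsRegularAffineAction σ) :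
    ∃ Φ : MvPolynomial (Fin n) K →ₐ[K] AddMonoidAlgebra (MvPolynomial (Fin n) K) (Fin r → ℤ),
      ∀ t x a, eval x (bbTwist Φ (bbEv t) a) = eval (σ t x) a := by
  classical
  obtain ⟨P, hP⟩ := hreg
  let y : Fin n → AddMonoidAlgebra (MvPolynomial (Fin n) K) (Fin r → ℤ) := fun i =>
    ∑ d ∈ (P i).support, ∑ m ∈ (P i d).support, AddMonoidAlgebra.single m (monomial d (P i d m))
  refine ⟨aeval y, fun t x a => ?_⟩
  have hX : ∀ i, eval x (bbTwist (aeval y) (bbEv t) (X i)) = eval (σ t x) (X i) := by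
    intro i
    rw [eval_X, hP, bbTwist, AlgHom.comp_apply, aeval_X]
    simp only [y, map_sum]
    unfold lEval
    simp only [Finsupp.sum]
    apply Finset.sum_congr rfl
    intro d _
    rw [Finset.sum_mul]
    apply Finset.sum_congr rfl
    intro m _
    have h1 : (AddMonoidAlgebra.liftNCAlgHom (AlgHom.id K (MvPolynomial (Fin n) K))
        (((algebraMap K (MvPolynomial (Fin n) K) : K →+* MvPolynomial (Fin n) K) :
          K →* MvPolynomial (Fin n) K).comp (bbEv t)) (fun _ _ => Commute.all _ _))
        (AddMonoidAlgebra.single m (monomial d (P i d m))) =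
        monomial d (P i d m) * C (bbChar K m t) := by
      simp [AddMonoidAlgebra.liftNCAlgHom, AddMonoidAlgebra.liftNCRingHom, bbEv,
        MvPolynomial.algebraMap_eq]
    rw [h1, map_mul, eval_C, eval_monomial, Finsupp.prod_fintype _ _ (by simp)]
    change _ * ∏ j, ((t j ^ m j : Kˣ) : K) = _
    ring
  have h2 : ((aeval x : MvPolynomial (Fin n) K →ₐ[K] K).comp (bbTwist (aeval y) (bbEv t))) =
      (aeval (σ t x) : MvPolynomial (Fin n) K →ₐ[K] K) := by
    apply MvPolynomial.algHom_ext
    intro i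
    have := hX i
    rw [AlgHom.comp_apply, aeval_eq_eval, aeval_eq_eval]
    exact this
  have h3 := congrArg (fun φ => φ a) h2
  simp only [AlgHom.comp_apply, aeval_eq_eval] at h3
  exact h3

end PartSix

/-- **(Białynicki-Birula)** Any effective regular action of the `(n-1)`-dimensional torus
on affine `n`-space over an algebraically closed field is linearizable. -/
theorem codim_one_torus_action_on_affine_space_linearizable
    {K : Type*} [Field K] [IsAlgClosed K] (n : ℕ)
    (σ : (Fin (n - 1) → Kˣ) → (Fin n → K) → (Fin n → K))
    (hid : ∀ x, σ 1 x = x)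
    (hcomp : ∀ t₁ t₂ x, σ t₁ (σ t₂ x) = σ (t₁ * t₂) x)
    (hreg : IsRegularAffineAction σ)
    (heff : ∀ t, t ≠ 1 → ∃ x, σ t x ≠ x) :
    ∃ β γ : (Fin n → K) → (Fin n → K),
      IsPolyMap β ∧ IsPolyMap γ ∧ (∀ x, γ (β x) = x) ∧ (∀ x, β (γ x) = x) ∧
      ∀ t, ∃ A : Matrix (Fin n) (Fin n) K, ∀ x, γ (σ t (β x)) = A.mulVec x := by
  classical
  obtain ⟨Φ, hev⟩ := bb_coaction hreg
  have hgr : BBGr Φ := bb_gr_of_action σ hid hcomp hev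
  have hE : ∀ l : Fin (n - 1) → ℤ, l ≠ 0 → ∃ u a, BBHom Φ u a ∧ a ≠ 0 ∧ ∑ j, l j * u j ≠ 0 := by
    intro l hl
    by_contra hcon
    push Not at hcon
    obtain ⟨j, hj⟩ := Function.ne_iff.1 hl
    obtain ⟨s, hs⟩ := bb_exists_zpow_ne (K := K) (l j) hj
    obtain ⟨x, hx⟩ := heff (fun j => s ^ l j) (fun h => hs (congrFun h j))
    apply hx
    have h1 : ∀ a, bbTwist Φ (bbEv fun j => s ^ l j) a = a := by
      refine hgr.induction ?_ ?_ ?_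
      · rw [map_zero]
      · intro a b ha hb; rw [map_add, ha, hb]
      · intro u a ha
        by_cases ha0 : a = 0
        · rw [ha0, map_zero]
        · have h2 := hcon u a ha ha0
          rw [ha.twist]
          have h3 : bbEv (fun j => s ^ l j) (Multiplicative.ofAdd u) = (1 : K) := by
            change ∏ j, (((s ^ l j) ^ u j : Kˣ) : K) = 1
            have h5 : ∏ j, (s ^ l j) ^ u j = 1 := by
              simp only [← zpow_mul]
              rw [bb_prod_zpow, h2, zpow_zero]
            rw [← Units.coe_prod, h5, Units.val_one]
          rw [h3, one_smul]
    funext i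
    have h4 := hev (fun j => s ^ l j) x (MvPolynomial.X i)
    rw [h1, MvPolynomial.eval_X, MvPolynomial.eval_X] at h4
    exact h4.symm
  obtain ⟨f, w, hf, htop⟩ := bb_generators rfl hgr hE
  have hsurj : ∀ i, ∃ G : MvPolynomial (Fin n) K, MvPolynomial.aeval f G = MvPolynomial.X i := by
    intro i
    have : (MvPolynomial.X i : MvPolynomial (Fin n) K) ∈ Algebra.adjoin K (Set.range f) := by
      rw [htop]; trivial
    rw [Algebra.adjoin_range_eq_range_aeval] at this
    exact this
  choose G hG using hsurj
  have hβγ : ∀ x : Fin n → K, (fun i => MvPolynomial.eval (fun j => MvPolynomial.eval x (f j)) (G i)) = x := by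
    intro x
    funext i
    have h1 := congrArg (MvPolynomial.eval x) (hG i)
    rw [MvPolynomial.eval_X] at h1
    rw [← h1, MvPolynomial.aeval_def, MvPolynomial.algebraMap_eq, MvPolynomial.eval₂_eq', map_sum,
      MvPolynomial.eval_eq']
    apply Finset.sum_congr rfl
    intro d _
    simp
  have hinj : Function.Injective (fun (x : Fin n → K) i => MvPolynomial.eval x (f i)) := by
    intro x y hxy
    have h1 : (fun j => MvPolynomial.eval x (f j)) = fun j => MvPolynomial.eval y (f j) := hxy
    rw [← hβγ x, ← hβγ y, h1]
  have hγβ : ∀ y : Fin n → K, (fun i => MvPolynomial.eval (fun j => MvPolynomial.eval y (G j)) (f i)) = y := by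
    intro y
    obtain ⟨x, rfl⟩ := ax_grothendieck_univ f hinj y
    have h1 := hβγ x
    simp only at h1 ⊢
    rw [h1]
  refine ⟨fun y i => MvPolynomial.eval y (G i), fun x i => MvPolynomial.eval x (f i), ⟨G, fun _ _ => rfl⟩,
    ⟨f, fun _ _ => rfl⟩, hγβ, hβγ, ?_⟩
  intro t
  refine ⟨Matrix.diagonal fun i => bbEv t (Multiplicative.ofAdd (w i)), fun y => ?_⟩
  funext i
  rw [Matrix.mulVec_diagonal]
  change MvPolynomial.eval (σ t (fun j => MvPolynomial.eval y (G j))) (f i) = _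
  rw [← hev, (hf i).twist, MvPolynomial.smul_eval]
  congr 1
  exact congrFun (hγβ y) i
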